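/- Let h = 2n+1 be an odd integer with n ≥ 1, let λ be an h-strict partition and let 0 ≤ i ≤ n. Then: (1) ψ_i(ψ_i(λ)) = λ; (2) ψ_i(λ) is restricted if and only if λ is restricted. -/

import Mathlib

/-- A partition: a weakly decreasing sequence of non-negative integers with
finite sum (finitely many nonzero parts), indexed from 0 (so `parts 0` is λ₁). -/
structure BPartition where
  parts : ℕ →₀ ℕ
  antitone : ∀ r, parts (r + 1) ≤ parts r

namespace BPartition

/-- The multiset of positive parts of a partition. -/
def partsM (lam : BPartition) : Multiset ℕ :=
  lam.parts.support.val.map (fun r => lam.parts r)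

/-- The Young diagram: nodes `(r, c)` with rows indexed from 0 and columns from 1. -/
def diagram (lam : BPartition) : Set (ℕ × ℕ) :=
  {x | 1 ≤ x.2 ∧ x.2 ≤ lam.parts x.1}

/-- A partition is strict if λ_r > λ_{r+1} whenever λ_r > 0. -/
def IsStrict (lam : BPartition) : Prop :=
  ∀ r, 0 < lam.parts r → lam.parts (r + 1) < lam.parts r

/-- A partition is h-strict if each part is either strictly bigger than the next,
or positive and divisible by h, or zero. -/
def IsHStrict (h : ℕ) (lam : BPartition) : Prop :=
  ∀ r, lam.parts (r + 1) < lam.parts r ∨ (0 < lam.parts r ∧ h ∣ lam.parts r) ∨ lam.parts r = 0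

/-- An h-strict partition is restricted if for every r either λ_{r+1} > λ_r − h,
or λ_{r+1} = λ_r − h and h does not divide λ_r. -/
def IsRestricted (h : ℕ) (lam : BPartition) : Prop :=
  ∀ r, lam.parts r < lam.parts (r + 1) + h ∨
    (lam.parts (r + 1) + h = lam.parts r ∧ ¬ h ∣ lam.parts r)

/-- The residue of a node in column c (1-indexed): the smaller of the residues of
c − 1 and of −c modulo h. -/
def colRes (h c : ℕ) : ℕ := min ((c - 1) % h) ((h - c % h) % h)

/-- `x` is an addable i-node of `lam`. -/
def Addable (h i : ℕ) (lam : BPartition) (x : ℕ × ℕ) : Prop :=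
  colRes h x.2 = i ∧ x ∉ diagram lam ∧
  ∃ nu : BPartition, IsHStrict h nu ∧ diagram lam ⊆ diagram nu ∧ x ∈ diagram nu ∧
    ∀ y ∈ diagram nu, y ∉ diagram lam → colRes h y.2 = i

/-- `x` is a removable i-node of `lam`. -/
def Removable (h i : ℕ) (lam : BPartition) (x : ℕ × ℕ) : Prop :=
  x ∈ diagram lam ∧
  ∃ mu : BPartition, IsHStrict h mu ∧ diagram mu ⊆ diagram lam ∧ x ∉ diagram mu ∧
    ∀ y ∈ diagram lam, y ∉ diagram mu → colRes h y.2 = i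

/-- Removal of a single h-bar from `lam` giving `mu`, recording the value `v`:
either a part `v ≥ h` is replaced by `v − h` (deleted if `v = h`), or two parts
summing to `h` are deleted, in which case `v` is the larger of the two. -/
def barStepRec (h : ℕ) (lam mu : BPartition) (v : ℕ) : Prop :=
  IsHStrict h mu ∧
  ((v = h ∧ v ∈ partsM lam ∧ partsM mu = (partsM lam).erase v) ∨
   (h < v ∧ v ∈ partsM lam ∧ partsM mu = (v - h) ::ₘ (partsM lam).erase v) ∨
   (∃ a b : ℕ, a + b = h ∧ a ∈ partsM lam ∧ b ∈ (partsM lam).erase a ∧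
      v = max a b ∧ partsM mu = ((partsM lam).erase a).erase b))

/-- Removal of a single h-bar. -/
def barStep (h : ℕ) (lam mu : BPartition) : Prop :=
  ∃ v, barStepRec h lam mu v

/-- An h-bar-core: an h-strict partition from which no h-bar can be removed. -/
def IsBarCore (h : ℕ) (lam : BPartition) : Prop :=
  IsHStrict h lam ∧ ∀ mu, ¬ barStep h lam mu

/-- A chain of `w` h-bar removals from `lam` down to `mu`. -/
def barChain (h : ℕ) : ℕ → BPartition → BPartition → Prop
  | 0, lam, mu => lam = mu
  | w + 1, lam, mu => ∃ nu, barStep h lam nu ∧ barChain h w nu mu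

/-- `lam ∈ P_{τ,w}`: `lam` is h-strict with h-bar-core `tau` and h-bar-weight `w`. -/
def InBlock (h : ℕ) (tau : BPartition) (w : ℕ) (lam : BPartition) : Prop :=
  IsHStrict h lam ∧ IsBarCore h tau ∧ barChain h w lam tau

/-- The left-to-right order on node positions along the edge of a Young diagram:
smaller column first; within a column, larger row first. -/
def posLE (x y : ℕ × ℕ) : Prop := x.2 < y.2 ∨ (x.2 = y.2 ∧ y.1 ≤ x.1)

/-- `x` is a normal i-node: a removable i-node surviving (as a − sign) in the
reduced i-signature; equivalently, every window of the i-signature ending at `x`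
contains strictly more removable than addable i-nodes. -/
def Normal (h i : ℕ) (lam : BPartition) (x : ℕ × ℕ) : Prop :=
  Removable h i lam x ∧ ∀ z : ℕ × ℕ, posLE z x →
    Set.ncard {y | Addable h i lam y ∧ posLE z y ∧ posLE y x} <
      Set.ncard {y | Removable h i lam y ∧ posLE z y ∧ posLE y x}

/-- `x` is a conormal i-node: an addable i-node surviving (as a + sign) in the
reduced i-signature. -/
def Conormal (h i : ℕ) (lam : BPartition) (x : ℕ × ℕ) : Prop :=
  Addable h i lam x ∧ ∀ z : ℕ × ℕ, posLE x z →
    Set.ncard {y | Removable h i lam y ∧ posLE x y ∧ posLE y z} <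
      Set.ncard {y | Addable h i lam y ∧ posLE x y ∧ posLE y z}

/-- The node set of ψ_i(λ): add the leftmost s − r conormal i-nodes if s ≥ r,
remove the rightmost r − s normal i-nodes if r > s, where r = #normal and
s = #conormal i-nodes. -/
noncomputable def psiSet (h i : ℕ) (lam : BPartition) : Set (ℕ × ℕ) :=
  if Set.ncard {x | Normal h i lam x} ≤ Set.ncard {x | Conormal h i lam x} then
    diagram lam ∪ {x | Conormal h i lam x ∧
      Set.ncard {y | Conormal h i lam y ∧ posLE y x} ≤
        Set.ncard {x | Conormal h i lam x} - Set.ncard {x | Normal h i lam x}}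
  else
    diagram lam \ {x | Normal h i lam x ∧
      Set.ncard {y | Normal h i lam y ∧ posLE x y} ≤
        Set.ncard {x | Normal h i lam x} - Set.ncard {x | Conormal h i lam x}}

open Classical in
/-- The involution ψ_i. -/
noncomputable def psi (h i : ℕ) (lam : BPartition) : BPartition :=
  if hex : ∃ mu : BPartition, diagram mu = psiSet h i lam then hex.choose else lam

/-- The set of occupied positions of the abacus display of a strict partition. -/
def abacus (lam : BPartition) : Set ℤ :=
  {a | a = 0 ∨ (0 < a ∧ a.toNat ∈ partsM lam) ∨ (a < 0 ∧ (-a).toNat ∉ partsM lam)}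

/-- The dominance order: λ ⊴ μ. -/
def domLE (lam mu : BPartition) : Prop :=
  ∀ r, ∑ s ∈ Finset.range r, lam.parts s ≤ ∑ s ∈ Finset.range r, mu.parts s

/-- Strict dominance: λ ◁ μ. -/
def domLT (lam mu : BPartition) : Prop := domLE lam mu ∧ lam ≠ mu

/-- Lexicographic order: λ <lex μ. -/
def lexLT (lam mu : BPartition) : Prop :=
  ∃ r, lam.parts r < mu.parts r ∧ ∀ s < r, lam.parts s = mu.parts s

/-- Colexicographic order: λ <colex μ. -/
def colexLT (lam mu : BPartition) : Prop :=
  ∃ r, mu.parts r < lam.parts r ∧ ∀ s, r < s → lam.parts s = mu.parts s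

/-- λ ↔ᵢ μ: every node of the symmetric difference of the diagrams has residue i. -/
def Link (h i : ℕ) (lam mu : BPartition) : Prop :=
  ∀ x : ℕ × ℕ, x ∈ (diagram lam \ diagram mu) ∪ (diagram mu \ diagram lam) →
    colRes h x.2 = i

/-- `a ≤ b` are the bar positions of `lam ∈ P_{τ,2}`: the values recorded by
some two-step removal of h-bars from `lam` down to `tau`. -/
def BarPositions (h : ℕ) (tau lam : BPartition) (a b : ℕ) : Prop :=
  a ≤ b ∧ ∃ (nu : BPartition) (v₁ v₂ : ℕ), barStepRec h lam nu v₁ ∧ barStepRec h nu tau v₂ ∧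
    ({a, b} : Multiset ℕ) = {v₁, v₂}

/-- The leg length of the bar of `lam ∈ P_{τ,2}` at bar position `c`. -/
noncomputable def legLen (h : ℕ) (tau lam : BPartition) (c : ℕ) : ℕ :=
  if h ≤ c then Set.ncard {x : ℕ | c - h < x ∧ x < c ∧ x ∈ partsM lam ∧ x ∈ partsM tau}
  else (h - c) + Set.ncard {x : ℕ | h - c < x ∧ x < c ∧ x ∈ partsM lam ∧ x ∈ partsM tau}

/-- ∂λ: the absolute difference of the two leg lengths of `lam`, whose bar
positions are `a ≤ b`. -/
noncomputable def ddd (h : ℕ) (tau lam : BPartition) (a b : ℕ) : ℕ :=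
  max (legLen h tau lam a) (legLen h tau lam b) - min (legLen h tau lam a) (legLen h tau lam b)

inductive Colour | black | white | grey
deriving DecidableEq

/-- β(τ): the number of parts of τ less than h. -/
def betaCount (h : ℕ) (tau : BPartition) : ℕ :=
  Multiset.card ((partsM tau).filter (fun x => x < h))

/-- The leg length of a 2h-bar of `lam` with larger bar position `b`. -/
noncomputable def legLen2 (h : ℕ) (tau lam : BPartition) (b : ℕ) : ℕ :=
  if 2 * h ≤ b then Set.ncard {x : ℕ | b - 2 * h < x ∧ x < b ∧ x ∈ partsM lam ∧ x ∈ partsM tau}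
  else (2 * h - b) + Set.ncard {x : ℕ | 2 * h - b < x ∧ x < b ∧ x ∈ partsM lam ∧ x ∈ partsM tau}

/-- The colour of `lam ∈ P_{τ,2}` with bar positions `a ≤ b`. -/
noncomputable def colour (h : ℕ) (tau lam : BPartition) (a b : ℕ) : Colour :=
  if 2 ≤ ddd h tau lam a b then Colour.grey
  else if ddd h tau lam a b = 1 then
    if h < b then Colour.grey
    else if (min (legLen h tau lam a) (legLen h tau lam b) + betaCount h tau) % 2 = 1 then
      Colour.black else Colour.white
  else
    if b = a + h ∨ a + b = 2 * h then
      if (legLen2 h tau lam b + 2 * betaCount h tau) % 4 = 0 ∨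
         (legLen2 h tau lam b + 2 * betaCount h tau) % 4 = 3 then Colour.black
      else Colour.white
    else
      if (legLen h tau lam a + betaCount h tau) % 2 = 1 then Colour.black else Colour.white

end BPartition

namespace SigP
open Finset

open Classical in
noncomputable def ind (P : ℕ → Prop) (c : ℕ) : ℕ := if P c then 1 else 0

noncomputable def Sg (p m : ℕ → Prop) (c : ℕ) : ℤ :=
  ∑ j ∈ range c, ((ind p j : ℤ) - (ind m j : ℤ))

noncomputable def Ct (F : ℕ → Prop) (c : ℕ) : ℤ := ∑ j ∈ range c, (ind F j : ℤ)

def Cn (p m : ℕ → Prop) (c : ℕ) : Prop := p c ∧ ∀ d, c ≤ d → Sg p m c < Sg p m (d + 1)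
def Nm (p m : ℕ → Prop) (c : ℕ) : Prop := m c ∧ ∀ d, d ≤ c → Sg p m (c + 1) < Sg p m d

theorem ind_pos {P : ℕ → Prop} {c : ℕ} (h : P c) : ind P c = 1 := by simp [ind, h]
theorem ind_neg {P : ℕ → Prop} {c : ℕ} (h : ¬ P c) : ind P c = 0 := by simp [ind, h]
theorem ind_le (P : ℕ → Prop) (c : ℕ) : ind P c ≤ 1 := by unfold ind; split_ifs <;> simp

theorem Sg_succ (p m : ℕ → Prop) (c : ℕ) :
    Sg p m (c + 1) = Sg p m c + ((ind p c : ℤ) - (ind m c : ℤ)) := by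
  unfold Sg; rw [sum_range_succ]

theorem Ct_succ (F : ℕ → Prop) (c : ℕ) : Ct F (c + 1) = Ct F c + (ind F c : ℤ) := by
  unfold Ct; rw [sum_range_succ]

theorem Ct_mono (F : ℕ → Prop) {c d : ℕ} (h : c ≤ d) : Ct F c ≤ Ct F d := by
  induction d, h using Nat.le_induction with
  | base => exact le_refl _
  | succ d _ ih => rw [Ct_succ]; omega

theorem Ct_const (F : ℕ → Prop) {c d : ℕ} (h : c ≤ d) (hF : ∀ x, c ≤ x → x < d → ¬ F x) :
    Ct F d = Ct F c := by
  induction d, h using Nat.le_induction with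
  | base => rfl
  | succ d hd ih =>
    rw [Ct_succ, ind_neg (hF d hd (Nat.lt_succ_self d)), ih (fun x h1 h2 => hF x h1 (by omega))]
    simp

/-- level lemma for conormals -/
theorem level_cn {p m F : ℕ → Prop}
    {f : ℕ} (hf : Cn p m f) (hF : ∀ c, c ≤ f → Cn p m c → F c) :
    ∀ k d, d + k = f → Sg p m f - Sg p m d ≤ Ct F f - Ct F d := by
  intro k
  induction k using Nat.strong_induction_on with
  | _ k ih =>
    intro d hd
    rcases Nat.eq_zero_or_pos k with h0 | h0
    · subst h0; have : d = f := by omega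
      subst this; simp
    · have h1 := ih (k - 1) (by omega) (d + 1) (by omega)
      rw [Sg_succ, Ct_succ] at h1
      have hp := ind_le p d
      by_cases hc : Cn p m d
      · rw [ind_pos (hF d (by omega) hc)] at h1
        omega
      · by_cases hpd : p d
        · have : ∃ e, d ≤ e ∧ Sg p m (e + 1) ≤ Sg p m d := by
            by_contra hcon
            push Not at hcon
            exact hc ⟨hpd, hcon⟩
          obtain ⟨e, he, hes⟩ := this
          rcases le_or_gt (e + 1) f with h2 | h2
          · have := ih (f - (e + 1)) (by omega) (e + 1) (by omega)
            have h3 := Ct_mono F (show d ≤ e + 1 by omega)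
            omega
          · have := hf.2 e (by omega)
            have h3 := Ct_mono F (show d ≤ f by omega)
            omega
        · rw [ind_neg hpd] at h1
          omega

/-- level lemma for normals -/
theorem level_nm {p m F : ℕ → Prop} 
    {f : ℕ} (hf : Nm p m f) (hF : ∀ c, f ≤ c → Nm p m c → F c) :
    ∀ d, f ≤ d → Sg p m (f + 1) - Sg p m (d + 1) ≤ Ct F (d + 1) - Ct F (f + 1) := by
  intro d
  induction d using Nat.strong_induction_on with
  | _ d ih =>
    intro hd
    rcases Nat.eq_or_lt_of_le hd with h0 | h0
    · subst h0; simp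
    · have h1 := ih (d - 1) (by omega) (by omega)
      rw [show d - 1 + 1 = d by omega] at h1
      have e1 := Sg_succ p m d
      have e2 := Ct_succ F d
      have hp := ind_le m d
      by_cases hc : Nm p m d
      · rw [ind_pos (hF d (by omega) hc)] at e2
        omega
      · by_cases hpd : m d
        · have : ∃ e, e ≤ d ∧ Sg p m e ≤ Sg p m (d + 1) := by
            by_contra hcon
            push Not at hcon
            exact hc ⟨hpd, hcon⟩
          obtain ⟨e, he, hes⟩ := this
          rcases le_or_gt (f + 1) e with h2 | h2
          · have := ih (e - 1) (by omega) (by omega)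
            rw [show e - 1 + 1 = e by omega] at this
            have h3 := Ct_mono F (show e ≤ d + 1 by omega)
            omega
          · have := hf.2 e (by omega)
            have h3 := Ct_mono F (show f + 1 ≤ d + 1 by omega)
            omega
        · rw [ind_neg hpd] at e1
          omega

theorem Sg_flip_add {p m p' m' F : ℕ → Prop} (hdis : ∀ c, p c → ¬ m c)
    (hFp : ∀ c, F c → p c)
    (hp' : ∀ c, p' c ↔ p c ∧ ¬ F c) (hm' : ∀ c, m' c ↔ m c ∨ F c) (c : ℕ) :
    Sg p' m' c = Sg p m c - 2 * Ct F c := by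
  induction c with
  | zero => simp [Sg, Ct]
  | succ c ih =>
    rw [Sg_succ, Sg_succ, Ct_succ, ih]
    have := hdis c
    have := hFp c
    have := hp' c
    have := hm' c
    unfold ind
    by_cases h1 : F c <;> by_cases h2 : p c <;> by_cases h3 : m c <;> simp_all <;> ring

theorem Sg_flip_sub {p m p' m' F : ℕ → Prop} (hdis : ∀ c, p c → ¬ m c)
    (hFp : ∀ c, F c → m c)
    (hp' : ∀ c, p' c ↔ p c ∨ F c) (hm' : ∀ c, m' c ↔ m c ∧ ¬ F c) (c : ℕ) :
    Sg p' m' c = Sg p m c + 2 * Ct F c := by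
  induction c with
  | zero => simp [Sg, Ct]
  | succ c ih =>
    rw [Sg_succ, Sg_succ, Ct_succ, ih]
    have := hdis c
    have := hFp c
    have := hp' c
    have := hm' c
    unfold ind
    by_cases h1 : F c <;> by_cases h2 : p c <;> by_cases h3 : m c <;> simp_all <;> ring

theorem nm_lt_cn {p m : ℕ → Prop} (hdis : ∀ c, p c → ¬ m c) {c d : ℕ}
    (hc : Nm p m c) (hd : Cn p m d) : c < d := by
  by_contra h
  rcases Nat.eq_or_lt_of_le (not_lt.1 h) with h | h
  · subst h; exact hdis _ hd.1 hc.1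
  · have h1 := hc.2 d h.le
    have h2 := hd.2 c h.le
    omega

theorem flip_add {p m p' m' F : ℕ → Prop} (hdis : ∀ c, p c → ¬ m c)
    (hFC : ∀ c, F c → Cn p m c) (hinit : ∀ c f, F f → Cn p m c → c ≤ f → F c)
    (hp' : ∀ c, p' c ↔ p c ∧ ¬ F c) (hm' : ∀ c, m' c ↔ m c ∨ F c) (c : ℕ) :
    (Nm p' m' c ↔ Nm p m c ∨ F c) ∧ (Cn p' m' c ↔ Cn p m c ∧ ¬ F c) := by
  have hS := Sg_flip_add hdis (fun c h => (hFC c h).1) hp' hm'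
  refine ⟨⟨?_, ?_⟩, ⟨?_, ?_⟩⟩
  · intro h
    by_cases hF : F c
    · exact Or.inr hF
    left
    have hm : m c := ((hm' c).1 h.1).resolve_right hF
    refine ⟨hm, ?_⟩
    by_cases hex : ∃ f, f < c ∧ F f
    · exfalso
      obtain ⟨f, ⟨hfc, hf⟩, hmax⟩ : ∃ f, (f < c ∧ F f) ∧ ∀ g, f < g → g < c → ¬ F g := by
        classical
        obtain ⟨f0, hf0⟩ := hex
        refine ⟨Nat.findGreatest (fun f => f < c ∧ F f) c, ?_, ?_⟩
        · exact Nat.findGreatest_spec (P := fun f => f < c ∧ F f) hf0.1.le hf0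
        · intro g hg hgc hFg
          exact Nat.findGreatest_is_greatest hg hgc.le ⟨hgc, hFg⟩
      have h1 := h.2 (f + 1) (by omega)
      rw [hS, hS] at h1
      have h2 : Ct F (c + 1) = Ct F (f + 1) := Ct_const F (by omega) (by
        intro x hx hx'
        by_cases hxc : x = c
        · subst hxc; exact hF
        · exact hmax x (by omega) (by omega))
      have h3 := (hFC f hf).2 c (by omega)
      have h4 := Sg_succ p m f
      have := ind_le p f
      omega
    · push Not at hex
      intro d hd
      have h1 := h.2 d hd
      rw [hS, hS] at h1
      have h2 : Ct F (c + 1) = Ct F d := Ct_const F (by omega) (by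
        intro x hx hx'
        by_cases hxc : x = c
        · subst hxc; exact hF
        · exact hex x (by omega))
      omega
  · rintro (h | h)
    · refine ⟨(hm' c).2 (Or.inl h.1), ?_⟩
      intro d hd
      rw [hS, hS]
      have h2 : Ct F (c + 1) = Ct F d := Ct_const F (by omega) (by
        intro x hx hx' hFx
        have := nm_lt_cn hdis h (hFC x hFx)
        omega)
      have := h.2 d hd
      omega
    · refine ⟨(hm' c).2 (Or.inr h), ?_⟩
      intro d hd
      rw [hS, hS]
      have h1 := level_cn (hFC c h) (fun x hx hx' => hinit x c h hx' hx) (c - d) d (by omega)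
      have h2 := Sg_succ p m c
      have h3 := Ct_succ F c
      have h4 := Ct_mono F hd
      rw [ind_pos h] at h3
      have := ind_le p c
      omega
  · intro h
    have h0 := (hp' c).1 h.1
    refine ⟨⟨h0.1, ?_⟩, h0.2⟩
    intro d hd
    have h1 := h.2 d hd
    rw [hS, hS] at h1
    have h4 := Ct_mono F (show c ≤ d + 1 by omega)
    omega
  · rintro ⟨h, hF⟩
    refine ⟨(hp' c).2 ⟨h.1, hF⟩, ?_⟩
    intro d hd
    rw [hS, hS]
    have h2 : Ct F (d + 1) = Ct F c := Ct_const F (by omega) (by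
        intro x hx hx' hFx
        exact hF (hinit c x hFx h hx))
    have := h.2 d hd
    omega

theorem flip_sub {p m p' m' F : ℕ → Prop} (hdis : ∀ c, p c → ¬ m c)
    (hFN : ∀ c, F c → Nm p m c) (hfin : ∀ c f, F f → Nm p m c → f ≤ c → F c)
    (hp' : ∀ c, p' c ↔ p c ∨ F c) (hm' : ∀ c, m' c ↔ m c ∧ ¬ F c) (c : ℕ) :
    (Nm p' m' c ↔ Nm p m c ∧ ¬ F c) ∧ (Cn p' m' c ↔ Cn p m c ∨ F c) := by
  have hS := Sg_flip_sub hdis (fun c h => (hFN c h).1) hp' hm'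
  refine ⟨⟨?_, ?_⟩, ⟨?_, ?_⟩⟩
  · intro h
    have h0 := (hm' c).1 h.1
    refine ⟨⟨h0.1, ?_⟩, h0.2⟩
    intro d hd
    have h1 := h.2 d hd
    rw [hS, hS] at h1
    have h4 := Ct_mono F (show d ≤ c + 1 by omega)
    omega
  · rintro ⟨h, hF⟩
    refine ⟨(hm' c).2 ⟨h.1, hF⟩, ?_⟩
    intro d hd
    rw [hS, hS]
    have h2 : Ct F (c + 1) = Ct F d := Ct_const F (by omega) (by
        intro x hx hx' hFx
        exact hF (hfin c x hFx h (by omega)))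
    have := h.2 d hd
    omega
  · intro h
    by_cases hF : F c
    · exact Or.inr hF
    left
    have hm : p c := ((hp' c).1 h.1).resolve_right hF
    refine ⟨hm, ?_⟩
    by_cases hex : ∃ f, c < f ∧ F f
    · exfalso
      obtain ⟨f, ⟨hfc, hf⟩, hmax⟩ : ∃ f, (c < f ∧ F f) ∧ ∀ g, g < f → c < g → ¬ F g := by
        classical
        refine ⟨Nat.find hex, Nat.find_spec hex, ?_⟩
        intro g hg hgc hFg
        exact Nat.find_min hex hg ⟨hgc, hFg⟩
      have h1 := h.2 (f - 1) (by omega)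
      rw [show f - 1 + 1 = f by omega, hS, hS] at h1
      have h2 : Ct F f = Ct F c := Ct_const F (by omega) (by
        intro x hx hx'
        by_cases hxc : x = c
        · subst hxc; exact hF
        · exact hmax x (by omega) (by omega))
      have h3 := (hFN f hf).2 c (by omega)
      have h4 := Sg_succ p m f
      have := ind_le m f
      omega
    · push Not at hex
      intro d hd
      have h1 := h.2 d hd
      rw [hS, hS] at h1
      have h2 : Ct F (d + 1) = Ct F c := Ct_const F (by omega) (by
        intro x hx hx'
        by_cases hxc : x = c
        · subst hxc; exact hF
        · exact hex x (by omega))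
      omega
  · rintro (h | h)
    · refine ⟨(hp' c).2 (Or.inl h.1), ?_⟩
      intro d hd
      rw [hS, hS]
      have h2 : Ct F (d + 1) = Ct F c := Ct_const F (by omega) (by
        intro x hx hx' hFx
        have := nm_lt_cn hdis (hFN x hFx) h
        omega)
      have := h.2 d hd
      omega
    · refine ⟨(hp' c).2 (Or.inr h), ?_⟩
      intro d hd
      rw [hS, hS]
      have h1 := level_nm (hFN c h) (fun x hx hx' => hfin x c h hx' hx) d hd
      have h2 := Sg_succ p m c
      have h3 := Ct_succ F c
      have h4 := Ct_mono F (show c + 1 ≤ d + 1 by omega)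
      rw [ind_pos h] at h3
      have := ind_le m c
      omega

/-- a plus followed by a minus with no plus in between is not conormal -/
theorem not_cn {p m : ℕ → Prop} (hdis : ∀ c, p c → ¬ m c) {c d : ℕ} (hcd : c < d)
    (hd : m d) (hno : ∀ x, c < x → x < d → ¬ p x) : ¬ Cn p m c := by
  intro h
  have key : ∀ k, c < k → k ≤ d → Sg p m k ≤ Sg p m c + 1 := by
    intro k hk
    induction k, hk using Nat.le_induction with
    | base => intro _; rw [Sg_succ]; have := ind_le p c; omega
    | succ k hk ih =>
      intro hkd
      have := ih (by omega)
      rw [Sg_succ, ind_neg (hno k hk (by omega))]; omega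
  have h1 := key d hcd le_rfl
  have h2 := h.2 d hcd.le
  have hpd : ¬ p d := fun hp => hdis d hp hd
  rw [Sg_succ, ind_pos hd, ind_neg hpd] at h2
  omega

theorem not_nm {p m : ℕ → Prop} (hdis : ∀ c, p c → ¬ m c) {c d : ℕ} (hcd : c < d)
    (hc : p c) (hno : ∀ x, c < x → x < d → ¬ m x) : ¬ Nm p m d := by
  intro h
  have key : ∀ k, c < k → k ≤ d → Sg p m c + 1 ≤ Sg p m k := by
    intro k hk
    induction k, hk using Nat.le_induction with
    | base => intro _; rw [Sg_succ, ind_pos hc, ind_neg (hdis c hc)]; omega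
    | succ k hk ih =>
      intro hkd
      have := ih (by omega)
      rw [Sg_succ, ind_neg (hno k hk (by omega))]; omega
  have h1 := key d hcd le_rfl
  have h2 := h.2 c hcd.le
  rw [Sg_succ] at h2
  have := ind_le m d
  omega

/-- adjacent pluses -/
theorem cn_adj {p m : ℕ → Prop} (hdis : ∀ c, p c → ¬ m c) {c : ℕ} (hc : p c)
    (h : Cn p m (c + 1)) : Cn p m c := by
  refine ⟨hc, ?_⟩
  intro d hd
  have e := Sg_succ p m c
  rw [ind_pos hc, ind_neg (hdis c hc)] at e
  rcases Nat.eq_or_lt_of_le hd with h1 | h1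
  · subst h1; omega
  · have := h.2 d h1
    omega

theorem nm_adj {p m : ℕ → Prop} (hdis : ∀ c, p c → ¬ m c) {c : ℕ} (hc : m (c + 1))
    (h : Nm p m c) : Nm p m (c + 1) := by
  refine ⟨hc, ?_⟩
  intro d hd
  have e := Sg_succ p m (c + 1)
  rw [ind_pos hc, ind_neg (fun hp => hdis _ hp hc)] at e
  rcases Nat.eq_or_lt_of_le hd with h1 | h1
  · subst h1; omega
  · have := h.2 d (by omega)
    omega

end SigP
namespace SigP

structure RH (h : ℕ) (R : ℕ → Prop) : Prop where
  h3 : 3 ≤ h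
  pos : ∀ c, R c → 1 ≤ c
  r1 : ∀ c, R c → R (c + 1) → h ∣ c
  r2 : ∀ c, 1 ≤ c → h ∣ c → (R c ↔ R (c + 1))
  r3 : ∀ c, 1 ≤ c → (R c ↔ R (c + h))

structure Vd (h : ℕ) (H : ℕ → ℕ) : Prop where
  anti : ∀ c, 1 ≤ c → H (c + 1) ≤ H c
  str : ∀ c, 1 ≤ c → ¬ h ∣ c → H c ≤ H (c + 1) + 1

def Pl (h : ℕ) (R : ℕ → Prop) (H : ℕ → ℕ) (c : ℕ) : Prop :=
  R c ∧ (h ∣ c ∨ H c ≤ H (c + 1)) ∧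
    (c = 1 ∨ H c < H (c - 1) ∨ (h ∣ c - 1 ∧ H c < H (c - 2)))

def Mi (h : ℕ) (R : ℕ → Prop) (H : ℕ → ℕ) (c : ℕ) : Prop :=
  R c ∧ (H (c + 1) < H c ∨ (h ∣ c ∧ H (c + 2) < H c)) ∧ (h ∣ c - 1 ∨ H (c - 1) ≤ H c)

theorem dvd_near {h a b : ℕ} (ha : h ∣ a) (hb : h ∣ b) (hab : a < b) : a + h ≤ b := by
  have h1 : h ∣ b - a := Nat.dvd_sub hb ha
  have := Nat.le_of_dvd (by omega) h1
  omega

theorem dvd_succ_not {h a : ℕ} (h3 : 3 ≤ h) (ha : h ∣ a) : ¬ h ∣ a + 1 := fun hb => by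
  have := dvd_near ha hb (by omega); omega
theorem dvd_succ2_not {h a : ℕ} (h3 : 3 ≤ h) (ha : h ∣ a) : ¬ h ∣ a + 2 := fun hb => by
  have := dvd_near ha hb (by omega); omega

theorem Vd.anti_le {h : ℕ} {H : ℕ → ℕ} (V : Vd h H) {a b : ℕ} (ha : 1 ≤ a) (hab : a ≤ b) :
    H b ≤ H a := by
  induction b, hab using Nat.le_induction with
  | base => exact le_rfl
  | succ b hb ih => exact (V.anti b (by omega)).trans ih

theorem pm_dis {h : ℕ} {R : ℕ → Prop} {H : ℕ → ℕ} (hR : RH h R) (c : ℕ)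
    (hp : Pl h R H c) : ¬ Mi h R H c := by
  intro hm
  obtain ⟨r, p1, p2⟩ := hp
  obtain ⟨-, m1, m2⟩ := hm
  have h3 := hR.h3
  have hc := hR.pos c r
  by_cases hd : h ∣ c
  · have hd1 : ¬ h ∣ c - 1 := fun hx => by
      have := dvd_succ_not h3 hx
      rw [show c - 1 + 1 = c by omega] at this
      exact this hd
    have : c ≠ 1 := by rintro rfl; simp at hd1
    grind
  · grind

theorem flip_vd_add {h : ℕ} {R F : ℕ → Prop} {H G : ℕ → ℕ} (hR : RH h R) (V : Vd h H)
    (iv : ∀ c, (F c ∧ G c = H c + 1) ∨ (¬ F c ∧ G c = H c))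
    (hF : ∀ c, F c → Pl h R H c)
    (hcl : ∀ c, 1 ≤ c → h ∣ c → F (c + 1) → Pl h R H c → F c) :
    Vd h G := by
  have h3 := hR.h3
  have d1 : ∀ c, h ∣ c → ¬ h ∣ c + 1 := fun c => dvd_succ_not h3
  have r1 := hR.r1
  have r2 := hR.r2
  have pos := hR.pos
  have anti := V.anti
  have str := V.str
  have d0 : h ∣ 0 := dvd_zero h
  unfold Pl at *
  have hFR : ∀ c, F c → R c := fun c hc => (hF c hc).1
  refine ⟨?_, ?_⟩
  · intro c hc
    have := iv c
    have := iv (c + 1)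
    have := hF (c + 1)
    have := hF c
    have := hcl c hc
    have := anti c hc
    have := r1 c
    have := r2 c hc
    have := d1 c
    have := anti (c + 1)
    have := iv (c + 2)
    simp only [Nat.add_sub_cancel, show c + 1 - 2 = c - 1 by omega, show c + 1 + 1 = c + 2 by omega] at *
    clear iv hF hFR hcl anti str r1 r2 d1 pos V hR
    grind
  · intro c hc hd
    have := iv c
    have := iv (c + 1)
    have := hF c
    have := hF (c + 1)
    have := str c hc
    simp only [Nat.add_sub_cancel] at *
    clear iv hF hFR hcl anti str r1 r2 d1 pos V hR
    grind

theorem flip_pl_add {h : ℕ} {R F : ℕ → Prop} {H G : ℕ → ℕ} (hR : RH h R) (V : Vd h H)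
    (iv : ∀ c, (F c ∧ G c = H c + 1) ∨ (¬ F c ∧ G c = H c))
    (hF : ∀ c, F c → Pl h R H c)
    (hcl : ∀ c, 1 ≤ c → h ∣ c → F (c + 1) → Pl h R H c → F c) :
    ∀ c, Pl h R G c ↔ Pl h R H c ∧ ¬ F c := by
  have h3 := hR.h3
  have d1 : ∀ c, h ∣ c → ¬ h ∣ c + 1 := fun c => dvd_succ_not h3
  have r1 := hR.r1
  have r2 := hR.r2
  have pos := hR.pos
  have anti := V.anti
  have str := V.str
  have d0 : h ∣ 0 := dvd_zero h
  unfold Pl at *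
  have hFR : ∀ c, F c → R c := fun c hc => (hF c hc).1
  intro c
  by_cases hr : R c
  swap
  · have := hFR c
    tauto
  have hc := pos c hr
  obtain ⟨b, rfl⟩ : ∃ b, c = b + 1 := ⟨c - 1, by omega⟩
  by_cases hd : h ∣ b + 1
  · obtain ⟨a, rfl⟩ : ∃ a, b = a + 1 := ⟨b - 1, by
      have : b ≠ 0 := by
        rintro rfl
        have := Nat.le_of_dvd (by omega) hd
        omega
      omega⟩
    have e1 : ¬ h ∣ a + 1 := fun hx => d1 _ hx hd
    have e2 : ¬ R (a + 1) := fun hx => e1 (r1 _ hx hr)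
    have e3 : ¬ F (a + 1) := fun hx => e2 (hFR _ hx)
    have e4 : R (a + 3) := (r2 _ (by omega) hd).1 hr
    have e5 : ¬ F (a + 4) := fun hx => d1 _ hd (r1 _ e4 (hFR _ hx))
    have := iv (a + 1)
    have := iv (a + 2)
    have := iv (a + 3)
    have := iv (a + 4)
    have := hF (a + 2)
    have := hF (a + 3)
    have := str (a + 1)
    have := str (a + 3)
    have := anti (a + 1)
    have := anti (a + 2)
    have := anti (a + 3)
    have := hcl (a + 2)
    have := d1 (a + 2)
    simp only [Nat.add_assoc, Nat.reduceAdd, show a + 3 - 1 = a + 2 by omega, show a + 2 - 1 = a + 1 by omega, show a + 3 - 2 = a + 1 by omega, show a + 2 - 2 = a by omega] at *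
    clear iv hF hFR hcl anti str r1 r2 d1 pos V hR
    grind
  · have e1 : ¬ R (b + 2) := fun hx => hd (r1 _ hr hx)
    have e2 : ¬ F (b + 2) := fun hx => e1 (hFR _ hx)
    by_cases hb : b = 0
    · subst hb
      have := iv 1
      have := iv 2
      have := hF 1
      have := anti 1
      have := str 1
      simp only [Nat.zero_add, Nat.reduceAdd, Nat.sub_self] at *
      clear iv hF hFR hcl anti str r1 r2 d1 pos V hR
      grind
    obtain ⟨a, rfl⟩ : ∃ a, b = a + 1 := ⟨b - 1, by omega⟩
    by_cases hd1 : h ∣ a + 1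
    · have e3 : R (a + 1) := (r2 _ (by omega) hd1).2 hr
      have e4 : ¬ F a := fun hx => d1 _ (r1 _ (hFR _ hx) e3) hd1
      have e5 : a ≠ 0 := by
        rintro rfl
        have := Nat.le_of_dvd (by omega) hd1
        omega
      have := iv a
      have := iv (a + 1)
      have := iv (a + 2)
      have := iv (a + 3)
      have := hF (a + 1)
      have := hF (a + 2)
      have := str a
      have := str (a + 2)
      have := anti a
      have := anti (a + 1)
      have := anti (a + 2)
      have := hcl (a + 1)
      have := d1 a
      have := d1 (a + 1)
      simp only [Nat.add_assoc, Nat.reduceAdd, show a + 1 - 1 = a by omega, show a + 2 - 1 = a + 1 by omega, show a + 2 - 2 = a by omega] at *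
      clear iv hF hFR hcl anti str r1 r2 d1 pos V hR
      grind
    · have e3 : ¬ F (a + 1) := fun hx => hd1 (r1 _ (hFR _ hx) hr)
      have := iv (a + 1)
      have := iv (a + 2)
      have := iv (a + 3)
      have := hF (a + 2)
      have := str (a + 1)
      have := str (a + 2)
      have := anti (a + 1)
      have := anti (a + 2)
      simp only [Nat.add_assoc, Nat.reduceAdd, show a + 2 - 1 = a + 1 by omega, show a + 2 - 2 = a by omega] at *
      clear iv hF hFR hcl anti str r1 r2 d1 pos V hR
      grind

theorem flip_mi_add {h : ℕ} {R F : ℕ → Prop} {H G : ℕ → ℕ} (hR : RH h R) (V : Vd h H)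
    (iv : ∀ c, (F c ∧ G c = H c + 1) ∨ (¬ F c ∧ G c = H c))
    (hF : ∀ c, F c → Pl h R H c)
    (hcl : ∀ c, 1 ≤ c → h ∣ c → F (c + 1) → Pl h R H c → F c) :
    ∀ c, Mi h R G c ↔ Mi h R H c ∨ F c := by
  have h3 := hR.h3
  have d1 : ∀ c, h ∣ c → ¬ h ∣ c + 1 := fun c => dvd_succ_not h3
  have r1 := hR.r1
  have r2 := hR.r2
  have pos := hR.pos
  have anti := V.anti
  have str := V.str
  have d0 : h ∣ 0 := dvd_zero h
  unfold Pl at *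
  have hFR : ∀ c, F c → R c := fun c hc => (hF c hc).1
  unfold Mi
  intro c
  by_cases hr : R c
  swap
  · have := hFR c
    tauto
  have hc := pos c hr
  obtain ⟨b, rfl⟩ : ∃ b, c = b + 1 := ⟨c - 1, by omega⟩
  by_cases hd : h ∣ b + 1
  · obtain ⟨a, rfl⟩ : ∃ a, b = a + 1 := ⟨b - 1, by
      have : b ≠ 0 := by
        rintro rfl
        have := Nat.le_of_dvd (by omega) hd
        omega
      omega⟩
    have e1 : ¬ h ∣ a + 1 := fun hx => d1 _ hx hd
    have e2 : ¬ R (a + 1) := fun hx => e1 (r1 _ hx hr)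
    have e3 : ¬ F (a + 1) := fun hx => e2 (hFR _ hx)
    have e4 : R (a + 3) := (r2 _ (by omega) hd).1 hr
    have e5 : ¬ F (a + 4) := fun hx => d1 _ hd (r1 _ e4 (hFR _ hx))
    have := iv (a + 1)
    have := iv (a + 2)
    have := iv (a + 3)
    have := iv (a + 4)
    have := hF (a + 2)
    have := hF (a + 3)
    have := str (a + 1)
    have := str (a + 3)
    have := anti (a + 1)
    have := anti (a + 2)
    have := anti (a + 3)
    have := hcl (a + 2)
    have := d1 (a + 2)
    simp only [Nat.add_assoc, Nat.reduceAdd, show a + 3 - 1 = a + 2 by omega, show a + 2 - 1 = a + 1 by omega, show a + 3 - 2 = a + 1 by omega, show a + 2 - 2 = a by omega] at *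
    clear iv hF hFR hcl anti str r1 r2 d1 pos V hR
    grind
  · have e1 : ¬ R (b + 2) := fun hx => hd (r1 _ hr hx)
    have e2 : ¬ F (b + 2) := fun hx => e1 (hFR _ hx)
    by_cases hb : b = 0
    · subst hb
      have := iv 1
      have := iv 2
      have := hF 1
      have := anti 1
      have := str 1
      simp only [Nat.zero_add, Nat.reduceAdd, Nat.sub_self] at *
      clear iv hF hFR hcl anti str r1 r2 d1 pos V hR
      grind
    obtain ⟨a, rfl⟩ : ∃ a, b = a + 1 := ⟨b - 1, by omega⟩
    by_cases hd1 : h ∣ a + 1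
    · have e3 : R (a + 1) := (r2 _ (by omega) hd1).2 hr
      have e4 : ¬ F a := fun hx => d1 _ (r1 _ (hFR _ hx) e3) hd1
      have e5 : a ≠ 0 := by
        rintro rfl
        have := Nat.le_of_dvd (by omega) hd1
        omega
      have := iv a
      have := iv (a + 1)
      have := iv (a + 2)
      have := iv (a + 3)
      have := hF (a + 1)
      have := hF (a + 2)
      have := str a
      have := str (a + 2)
      have := anti a
      have := anti (a + 1)
      have := anti (a + 2)
      have := hcl (a + 1)
      have := d1 a
      have := d1 (a + 1)
      simp only [Nat.add_assoc, Nat.reduceAdd, show a + 1 - 1 = a by omega, show a + 2 - 1 = a + 1 by omega, show a + 2 - 2 = a by omega] at *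
      clear iv hF hFR hcl anti str r1 r2 d1 pos V hR
      grind
    · have e3 : ¬ F (a + 1) := fun hx => hd1 (r1 _ (hFR _ hx) hr)
      have := iv (a + 1)
      have := iv (a + 2)
      have := iv (a + 3)
      have := hF (a + 2)
      have := str (a + 1)
      have := str (a + 2)
      have := anti (a + 1)
      have := anti (a + 2)
      simp only [Nat.add_assoc, Nat.reduceAdd, show a + 2 - 1 = a + 1 by omega, show a + 2 - 2 = a by omega] at *
      clear iv hF hFR hcl anti str r1 r2 d1 pos V hR
      grind

theorem flip_vd_sub {h : ℕ} {R F : ℕ → Prop} {H G : ℕ → ℕ} (hR : RH h R) (V : Vd h G)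
    (iv : ∀ c, (F c ∧ G c = H c + 1) ∨ (¬ F c ∧ G c = H c))
    (hF : ∀ c, F c → Mi h R G c)
    (hcl : ∀ c, 1 ≤ c → h ∣ c → F c → Mi h R G (c + 1) → F (c + 1)) :
    Vd h H := by
  have h3 := hR.h3
  have d1 : ∀ c, h ∣ c → ¬ h ∣ c + 1 := fun c => dvd_succ_not h3
  have r1 := hR.r1
  have r2 := hR.r2
  have pos := hR.pos
  have anti := V.anti
  have str := V.str
  have d0 : h ∣ 0 := dvd_zero h
  unfold Mi at *
  have hFR : ∀ c, F c → R c := fun c hc => (hF c hc).1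
  refine ⟨?_, ?_⟩
  · intro c hc
    have := iv c
    have := iv (c + 1)
    have := hF (c + 1)
    have := hF c
    have := hcl c hc
    have := anti c hc
    have := r1 c
    have := r2 c hc
    have := d1 c
    have := anti (c + 1)
    have := iv (c + 2)
    simp only [Nat.add_sub_cancel, show c + 1 - 2 = c - 1 by omega, show c + 1 + 1 = c + 2 by omega] at *
    clear iv hF hFR hcl anti str r1 r2 d1 pos V hR
    grind
  · intro c hc hd
    have := iv c
    have := iv (c + 1)
    have := hF c
    have := hF (c + 1)
    have := str c hc
    simp only [Nat.add_sub_cancel] at *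
    clear iv hF hFR hcl anti str r1 r2 d1 pos V hR
    grind

theorem flip_pl_sub {h : ℕ} {R F : ℕ → Prop} {H G : ℕ → ℕ} (hR : RH h R) (V : Vd h G)
    (iv : ∀ c, (F c ∧ G c = H c + 1) ∨ (¬ F c ∧ G c = H c))
    (hF : ∀ c, F c → Mi h R G c)
    (hcl : ∀ c, 1 ≤ c → h ∣ c → F c → Mi h R G (c + 1) → F (c + 1)) :
    ∀ c, Pl h R H c ↔ Pl h R G c ∨ F c := by
  have h3 := hR.h3
  have d1 : ∀ c, h ∣ c → ¬ h ∣ c + 1 := fun c => dvd_succ_not h3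
  have r1 := hR.r1
  have r2 := hR.r2
  have pos := hR.pos
  have anti := V.anti
  have str := V.str
  have d0 : h ∣ 0 := dvd_zero h
  unfold Mi at *
  have hFR : ∀ c, F c → R c := fun c hc => (hF c hc).1
  unfold Pl
  intro c
  by_cases hr : R c
  swap
  · have := hFR c
    tauto
  have hc := pos c hr
  obtain ⟨b, rfl⟩ : ∃ b, c = b + 1 := ⟨c - 1, by omega⟩
  by_cases hd : h ∣ b + 1
  · obtain ⟨a, rfl⟩ : ∃ a, b = a + 1 := ⟨b - 1, by
      have : b ≠ 0 := by
        rintro rfl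
        have := Nat.le_of_dvd (by omega) hd
        omega
      omega⟩
    have e1 : ¬ h ∣ a + 1 := fun hx => d1 _ hx hd
    have e2 : ¬ R (a + 1) := fun hx => e1 (r1 _ hx hr)
    have e3 : ¬ F (a + 1) := fun hx => e2 (hFR _ hx)
    have e4 : R (a + 3) := (r2 _ (by omega) hd).1 hr
    have e5 : ¬ F (a + 4) := fun hx => d1 _ hd (r1 _ e4 (hFR _ hx))
    have := iv (a + 1)
    have := iv (a + 2)
    have := iv (a + 3)
    have := iv (a + 4)
    have := hF (a + 2)
    have := hF (a + 3)
    have := str (a + 1)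
    have := str (a + 3)
    have := anti (a + 1)
    have := anti (a + 2)
    have := anti (a + 3)
    have := hcl (a + 2)
    have := d1 (a + 2)
    simp only [Nat.add_assoc, Nat.reduceAdd, show a + 3 - 1 = a + 2 by omega, show a + 2 - 1 = a + 1 by omega, show a + 3 - 2 = a + 1 by omega, show a + 2 - 2 = a by omega] at *
    clear iv hF hFR hcl anti str r1 r2 d1 pos V hR
    grind
  · have e1 : ¬ R (b + 2) := fun hx => hd (r1 _ hr hx)
    have e2 : ¬ F (b + 2) := fun hx => e1 (hFR _ hx)
    by_cases hb : b = 0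
    · subst hb
      have := iv 1
      have := iv 2
      have := hF 1
      have := anti 1
      have := str 1
      simp only [Nat.zero_add, Nat.reduceAdd, Nat.sub_self] at *
      clear iv hF hFR hcl anti str r1 r2 d1 pos V hR
      grind
    obtain ⟨a, rfl⟩ : ∃ a, b = a + 1 := ⟨b - 1, by omega⟩
    by_cases hd1 : h ∣ a + 1
    · have e3 : R (a + 1) := (r2 _ (by omega) hd1).2 hr
      have e4 : ¬ F a := fun hx => d1 _ (r1 _ (hFR _ hx) e3) hd1
      have e5 : a ≠ 0 := by
        rintro rfl
        have := Nat.le_of_dvd (by omega) hd1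
        omega
      have := iv a
      have := iv (a + 1)
      have := iv (a + 2)
      have := iv (a + 3)
      have := hF (a + 1)
      have := hF (a + 2)
      have := str a
      have := str (a + 2)
      have := anti a
      have := anti (a + 1)
      have := anti (a + 2)
      have := hcl (a + 1)
      have := d1 a
      have := d1 (a + 1)
      simp only [Nat.add_assoc, Nat.reduceAdd, show a + 1 - 1 = a by omega, show a + 2 - 1 = a + 1 by omega, show a + 2 - 2 = a by omega] at *
      clear iv hF hFR hcl anti str r1 r2 d1 pos V hR
      grind
    · have e3 : ¬ F (a + 1) := fun hx => hd1 (r1 _ (hFR _ hx) hr)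
      have := iv (a + 1)
      have := iv (a + 2)
      have := iv (a + 3)
      have := hF (a + 2)
      have := str (a + 1)
      have := str (a + 2)
      have := anti (a + 1)
      have := anti (a + 2)
      simp only [Nat.add_assoc, Nat.reduceAdd, show a + 2 - 1 = a + 1 by omega, show a + 2 - 2 = a by omega] at *
      clear iv hF hFR hcl anti str r1 r2 d1 pos V hR
      grind

theorem flip_mi_sub {h : ℕ} {R F : ℕ → Prop} {H G : ℕ → ℕ} (hR : RH h R) (V : Vd h G)
    (iv : ∀ c, (F c ∧ G c = H c + 1) ∨ (¬ F c ∧ G c = H c))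
    (hF : ∀ c, F c → Mi h R G c)
    (hcl : ∀ c, 1 ≤ c → h ∣ c → F c → Mi h R G (c + 1) → F (c + 1)) :
    ∀ c, Mi h R H c ↔ Mi h R G c ∧ ¬ F c := by
  have h3 := hR.h3
  have d1 : ∀ c, h ∣ c → ¬ h ∣ c + 1 := fun c => dvd_succ_not h3
  have r1 := hR.r1
  have r2 := hR.r2
  have pos := hR.pos
  have anti := V.anti
  have str := V.str
  have d0 : h ∣ 0 := dvd_zero h
  unfold Mi at *
  have hFR : ∀ c, F c → R c := fun c hc => (hF c hc).1
  intro c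
  by_cases hr : R c
  swap
  · have := hFR c
    tauto
  have hc := pos c hr
  obtain ⟨b, rfl⟩ : ∃ b, c = b + 1 := ⟨c - 1, by omega⟩
  by_cases hd : h ∣ b + 1
  · obtain ⟨a, rfl⟩ : ∃ a, b = a + 1 := ⟨b - 1, by
      have : b ≠ 0 := by
        rintro rfl
        have := Nat.le_of_dvd (by omega) hd
        omega
      omega⟩
    have e1 : ¬ h ∣ a + 1 := fun hx => d1 _ hx hd
    have e2 : ¬ R (a + 1) := fun hx => e1 (r1 _ hx hr)
    have e3 : ¬ F (a + 1) := fun hx => e2 (hFR _ hx)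
    have e4 : R (a + 3) := (r2 _ (by omega) hd).1 hr
    have e5 : ¬ F (a + 4) := fun hx => d1 _ hd (r1 _ e4 (hFR _ hx))
    have := iv (a + 1)
    have := iv (a + 2)
    have := iv (a + 3)
    have := iv (a + 4)
    have := hF (a + 2)
    have := hF (a + 3)
    have := str (a + 1)
    have := str (a + 3)
    have := anti (a + 1)
    have := anti (a + 2)
    have := anti (a + 3)
    have := hcl (a + 2)
    have := d1 (a + 2)
    simp only [Nat.add_assoc, Nat.reduceAdd, show a + 3 - 1 = a + 2 by omega, show a + 2 - 1 = a + 1 by omega, show a + 3 - 2 = a + 1 by omega, show a + 2 - 2 = a by omega] at *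
    clear iv hF hFR hcl anti str r1 r2 d1 pos V hR
    grind
  · have e1 : ¬ R (b + 2) := fun hx => hd (r1 _ hr hx)
    have e2 : ¬ F (b + 2) := fun hx => e1 (hFR _ hx)
    by_cases hb : b = 0
    · subst hb
      have := iv 1
      have := iv 2
      have := hF 1
      have := anti 1
      have := str 1
      simp only [Nat.zero_add, Nat.reduceAdd, Nat.sub_self] at *
      clear iv hF hFR hcl anti str r1 r2 d1 pos V hR
      grind
    obtain ⟨a, rfl⟩ : ∃ a, b = a + 1 := ⟨b - 1, by omega⟩
    by_cases hd1 : h ∣ a + 1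
    · have e3 : R (a + 1) := (r2 _ (by omega) hd1).2 hr
      have e4 : ¬ F a := fun hx => d1 _ (r1 _ (hFR _ hx) e3) hd1
      have e5 : a ≠ 0 := by
        rintro rfl
        have := Nat.le_of_dvd (by omega) hd1
        omega
      have := iv a
      have := iv (a + 1)
      have := iv (a + 2)
      have := iv (a + 3)
      have := hF (a + 1)
      have := hF (a + 2)
      have := str a
      have := str (a + 2)
      have := anti a
      have := anti (a + 1)
      have := anti (a + 2)
      have := hcl (a + 1)
      have := d1 a
      have := d1 (a + 1)
      simp only [Nat.add_assoc, Nat.reduceAdd, show a + 1 - 1 = a by omega, show a + 2 - 1 = a + 1 by omega, show a + 2 - 2 = a by omega] at *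
      clear iv hF hFR hcl anti str r1 r2 d1 pos V hR
      grind
    · have e3 : ¬ F (a + 1) := fun hx => hd1 (r1 _ (hFR _ hx) hr)
      have := iv (a + 1)
      have := iv (a + 2)
      have := iv (a + 3)
      have := hF (a + 2)
      have := str (a + 1)
      have := str (a + 2)
      have := anti (a + 1)
      have := anti (a + 2)
      simp only [Nat.add_assoc, Nat.reduceAdd, show a + 2 - 1 = a + 1 by omega, show a + 2 - 2 = a by omega] at *
      clear iv hF hFR hcl anti str r1 r2 d1 pos V hR
      grind

end SigP
namespace SigP

def Gap (h : ℕ) (H : ℕ → ℕ) (p : ℕ) : Prop :=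
  1 ≤ p ∧ H (p + 1) < H p ∧ ((¬ h ∣ p ∧ h < p ∧ H (p - h) = H p) ∨ (h ∣ p ∧ H (p - h + 1) = H p))

theorem gap1 {h : ℕ} {H : ℕ → ℕ} {q : ℕ} (hq : 1 ≤ q) (hd : ¬ h ∣ q) (h1 : H (q + h + 1) < H (q + h))
    (h2 : H q = H (q + h)) : ∃ p, Gap h H p := by
  refine ⟨q + h, by omega, h1, Or.inl ⟨?_, by omega, by simpa using h2⟩⟩
  rwa [Nat.dvd_add_left (dvd_refl h)]

theorem gap2 {h : ℕ} {H : ℕ → ℕ} {q : ℕ} (h3 : 3 ≤ h) (hd : h ∣ q) (h1 : H (q + h + 1) < H (q + h))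
    (h2 : H (q + 1) = H (q + h)) : ∃ p, Gap h H p := by
  refine ⟨q + h, by omega, h1, Or.inr ⟨?_, by simpa using h2⟩⟩
  rwa [Nat.dvd_add_left (dvd_refl h)]

theorem gap_cases {h : ℕ} {H : ℕ → ℕ} {p : ℕ} (hg : Gap h H p) :
    ∃ q, H (q + h + 1) < H (q + h) ∧
      ((1 ≤ q ∧ ¬ h ∣ q ∧ H q = H (q + h)) ∨ (h ∣ q ∧ H (q + 1) = H (q + h))) := by
  obtain ⟨h0, h1, ⟨a, b, c⟩ | ⟨a, c⟩⟩ := hg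
  · obtain ⟨q, rfl⟩ : ∃ q, p = q + h := ⟨p - h, by omega⟩
    refine ⟨q, h1, Or.inl ⟨by omega, ?_, by simpa using c⟩⟩
    rwa [Nat.dvd_add_left (dvd_refl h)] at a
  · obtain ⟨q, rfl⟩ : ∃ q, p = q + h := ⟨p - h, by have := Nat.le_of_dvd h0 a; omega⟩
    refine ⟨q, h1, Or.inr ⟨?_, by simpa using c⟩⟩
    rwa [Nat.dvd_add_left (dvd_refl h)] at a

theorem Vd.const {h : ℕ} {H : ℕ → ℕ} (V : Vd h H) {a b : ℕ} (ha : 1 ≤ a) (he : H a = H b) :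
    ∀ c, a ≤ c → c ≤ b → H c = H b := by
  intro c h1 h2
  have := V.anti_le ha h1
  have := V.anti_le (ha.trans h1) h2
  omega

theorem gap_fwd {h : ℕ} {R F : ℕ → Prop} {H G : ℕ → ℕ} (hR : RH h R) (V : Vd h H) (W : Vd h G)
    (iv : ∀ c, (F c ∧ G c = H c + 1) ∨ (¬ F c ∧ G c = H c))
    (hF : ∀ c, F c → Cn (Pl h R H) (Mi h R H) c)
    (hg : ∃ p, Gap h H p) : ∃ p, Gap h G p := by
  obtain ⟨p, hp⟩ := hg
  obtain ⟨q, g1, hq⟩ := gap_cases hp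
  have h3 := hR.h3
  have hFR : ∀ c, F c → R c := fun c hc => (hF c hc).1.1
  have hdd : ∀ x, h ∣ x + h ↔ h ∣ x := fun x => Nat.dvd_add_left (dvd_refl h)
  have d1 : ∀ c, h ∣ c → ¬ h ∣ c + 1 := fun c => dvd_succ_not h3
  have dis := pm_dis (H := H) hR
  have hFm : ∀ c, F c → ¬ Mi h R H c := fun c hc => dis c (hF c hc).1
  -- if a column next to an F column
  have nx : ∀ c, F c → ¬ h ∣ c → G (c + 1) = H (c + 1) := by
    intro c hc hd
    rcases iv (c + 1) with h1 | h1
    · exact absurd (hR.r1 c (hFR _ hc) (hFR _ h1.1)) hd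
    · exact h1.2
  rcases hq with ⟨q1, hd, he⟩ | ⟨hd, he⟩
  · have cst := V.const q1 he
    have hdp : ¬ h ∣ q + h := by rwa [hdd]
    have hmi : R (q + h) → Mi h R H (q + h) := by
      intro hr
      refine ⟨hr, Or.inl g1, Or.inr ?_⟩
      rw [cst (q + h - 1) (by omega) (by omega)]
    have f1 : ¬ F (q + h) := fun hf => hFm _ hf (hmi (hFR _ hf))
    have f2 : ¬ F q := by
      intro hf
      refine not_cn dis (show q < q + h by omega) (hmi ((hR.r3 q q1).1 (hFR _ hf))) ?_ (hF q hf)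
      rintro x hx hx' ⟨-, -, p2⟩
      rw [cst x (by omega) (by omega), cst (x - 1) (by omega) (by omega)] at p2
      rcases p2 with p2 | p2 | ⟨p2, p3⟩
      · omega
      · omega
      · by_cases hxq : x - 1 = q
        · rw [hxq] at p2; exact hd p2
        · rw [cst (x - 2) (by omega) (by omega)] at p3; omega
    have e1 : G (q + h) = H (q + h) := by have := iv (q + h); tauto
    have e2 : G q = H (q + h) := by have := iv q; rw [← he]; tauto
    have cst' := W.const q1 (e2.trans e1.symm)
    rcases iv (q + h + 1) with ⟨hf, h1⟩ | ⟨hf, h1⟩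
    swap
    · exact gap1 q1 hd (by omega) (by omega)
    have s1 := V.str (q + h) (by omega) hdp
    by_cases hdn : h ∣ q + 1
    · have a1 := V.anti (q + h + 1) (by omega)
      have a3 := W.anti (q + h + 1) (by omega)
      rw [show q + h + 1 + 1 = q + h + 2 by omega] at a1 a3
      by_cases hlt : G (q + h + 2) < H (q + h)
      · refine gap2 (q := q + 1) h3 hdn ?_ ?_
        · rw [show q + 1 + h = q + h + 1 by omega]
          rw [show q + h + 1 + 1 = q + h + 2 by omega]
          omega
        · rw [show q + 1 + h = q + h + 1 by omega, cst' (q + 1 + 1) (by omega) (by omega)]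
          omega
      · rcases iv (q + h + 2) with ⟨hf', h2⟩ | ⟨hf', h2⟩
        swap
        · omega
        refine gap1 (q := q + 2) (by omega) (d1 _ hdn) ?_ ?_
        · have := nx _ hf' (by
            have := d1 _ hdn
            rwa [← hdd, show q + 1 + 1 + h = q + h + 2 by omega] at this)
          have a2 := V.anti (q + h + 2) (by omega)
          rw [show q + 2 + h = q + h + 2 by omega]
          omega
        · rw [show q + 2 + h = q + h + 2 by omega, cst' (q + 2) (by omega) (by omega)]
          omega
    · have := nx _ hf (by rwa [show q + h + 1 = q + 1 + h by omega, hdd])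
      refine gap1 (q := q + 1) (by omega) hdn ?_ ?_
      · have a1 := V.anti (q + h + 1) (by omega)
        rw [show q + 1 + h = q + h + 1 by omega]
        omega
      · rw [show q + 1 + h = q + h + 1 by omega, cst' (q + 1) (by omega) (by omega)]
        omega
  · have cst := V.const (by omega) he
    have hdp : h ∣ q + h := by rwa [hdd]
    have hmi : R (q + h) → Mi h R H (q + h) := by
      intro hr
      refine ⟨hr, Or.inl g1, Or.inr ?_⟩
      rw [cst (q + h - 1) (by omega) (by omega)]
    have f1 : ¬ F (q + h) := fun hf => hFm _ hf (hmi (hFR _ hf))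
    have f2 : ¬ F (q + 1) := by
      intro hf
      have hr := (hR.r3 (q + 1) (by omega)).1 (hFR _ hf)
      rw [show q + 1 + h = q + h + 1 by omega] at hr
      refine not_cn dis (show q + 1 < q + h by omega)
        (hmi ((hR.r2 _ (by omega) hdp).2 hr)) ?_ (hF _ hf)
      rintro x hx hx' ⟨-, -, p2⟩
      rw [cst x (by omega) (by omega), cst (x - 1) (by omega) (by omega)] at p2
      rcases p2 with p2 | p2 | ⟨p2, p3⟩
      · omega
      · omega
      · have := dvd_near hd p2 (by omega)
        omega
    have e1 : G (q + h) = H (q + h) := by have := iv (q + h); tauto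
    have e2 : G (q + 1) = H (q + h) := by have := iv (q + 1); rw [← he]; tauto
    have cst' := W.const (by omega) (e2.trans e1.symm)
    by_cases hlt : G (q + h + 1) < H (q + h)
    · exact gap2 (q := q) h3 hd (by omega) (by omega)
    rcases iv (q + h + 1) with ⟨hf, h1⟩ | ⟨hf, h1⟩
    swap
    · omega
    refine gap1 (q := q + 1) (by omega) (d1 _ hd) ?_ ?_
    · have := nx _ hf (d1 _ hdp)
      have a1 := V.anti (q + h + 1) (by omega)
      rw [show q + 1 + h = q + h + 1 by omega]
      omega
    · rw [show q + 1 + h = q + h + 1 by omega]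
      omega

theorem gap_bwd {h : ℕ} {R F : ℕ → Prop} {H G : ℕ → ℕ} (hR : RH h R) (V : Vd h H) (W : Vd h G)
    (iv : ∀ c, (F c ∧ G c = H c + 1) ∨ (¬ F c ∧ G c = H c))
    (hF : ∀ c, F c → Nm (Pl h R G) (Mi h R G) c)
    (hg : ∃ p, Gap h G p) : ∃ p, Gap h H p := by
  obtain ⟨p, hp⟩ := hg
  obtain ⟨q, g1, hq⟩ := gap_cases hp
  have h3 := hR.h3
  have hFR : ∀ c, F c → R c := fun c hc => (hF c hc).1.1
  have hdd : ∀ x, h ∣ x + h ↔ h ∣ x := fun x => Nat.dvd_add_left (dvd_refl h)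
  have d1 : ∀ c, h ∣ c → ¬ h ∣ c + 1 := fun c => dvd_succ_not h3
  have dis := pm_dis (H := G) hR
  have hle : ∀ c, H c ≤ G c := fun c => by have := iv c; omega
  have pv : ∀ c, R (c + 1) → ¬ h ∣ c → G c = H c := by
    intro c hc hd
    rcases iv c with h1 | h1
    · exact absurd (hR.r1 c (hFR _ h1.1) hc) hd
    · exact h1.2
  rcases hq with ⟨q1, hd, he⟩ | ⟨hd, he⟩
  · have cst := W.const q1 he
    have hdp : ¬ h ∣ q + h := by rwa [hdd]
    have nomi : ∀ x, q ≤ x → x + 1 < q + h → ¬ Mi h R G x := by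
      rintro x hx hx' ⟨-, p1, -⟩
      rw [cst x (by omega) (by omega), cst (x + 1) (by omega) (by omega)] at p1
      rcases p1 with p1 | ⟨-, p1⟩
      · omega
      · rw [cst (x + 2) (by omega) (by omega)] at p1
        omega
    have nof : ∀ x, q ≤ x → x + 1 < q + h → H x = G (q + h) := by
      intro x hx hx'
      have := iv x
      rw [cst x (by omega) (by omega)] at this
      have h1 := nomi x hx hx'
      have h2 := hF x
      rcases this with h4 | h4
      · exact absurd (h2 h4.1).1 h1
      · exact h4.2.symm
    have e2 := nof q le_rfl (by omega)
    rcases iv (q + h) with ⟨hf, h1⟩ | ⟨hf, h1⟩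
    swap
    · refine gap1 q1 hd ?_ (by omega)
      have := hle (q + h + 1)
      omega
    have hrq : R q := (hR.r3 q q1).2 (hFR _ hf)
    -- plus at q
    have plq : (q = 1 ∨ G q < G (q - 1) ∨ (h ∣ q - 1 ∧ G q < G (q - 2))) → Pl h R G q := by
      intro hx
      refine ⟨hrq, Or.inr ?_, hx⟩
      rw [cst q (by omega) (by omega), cst (q + 1) (by omega) (by omega)]
    by_cases hd1 : h ∣ q - 1
    · have hdp1 : h ∣ q - 1 + h := by rwa [hdd]
      by_cases hf1 : F (q + h - 1)
      · have npl : ¬ Pl h R G q := by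
          intro hpl
          refine not_nm dis (show q < q + h - 1 by omega) hpl ?_ (hF _ hf1)
          intro x hx hx'
          exact nomi x (by omega) (by omega)
        have hx := mt plq npl
        push Not at hx
        obtain ⟨x1, x2, x4⟩ := hx
        have x3 := x4 hd1
        have hq4 : h ≤ q - 1 := Nat.le_of_dvd (by omega) hd1
        have hr1 : R (q - 1) := by
          rw [hR.r2 (q - 1) (by omega) hd1, show q - 1 + 1 = q by omega]; exact hrq
        have hdq2 : ¬ h ∣ q - 2 := fun hh => by
          have := d1 _ hh
          rw [show q - 2 + 1 = q - 1 by omega] at this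
          exact this hd1
        have y1 := pv (q - 2) (by rw [show q - 2 + 1 = q - 1 by omega]; exact hr1) hdq2
        have y2 := W.anti_le (show 1 ≤ q - 2 by omega) (show q - 2 ≤ q by omega)
        have y3 := nof (q + h - 2) (by omega) (by omega)
        refine gap1 (q := q - 2) (by omega) hdq2 ?_ ?_
        · rw [show q - 2 + h + 1 = q + h - 1 by omega, show q - 2 + h = q + h - 2 by omega]
          rcases iv (q + h - 1) with h5 | h5
          · rw [cst (q + h - 1) (by omega) (by omega)] at h5
            omega
          · exact absurd hf1 h5.1
        · rw [show q - 2 + h = q + h - 2 by omega]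
          omega
      · refine gap2 (q := q - 1) h3 hd1 ?_ ?_
        · rw [show q - 1 + h + 1 = q + h by omega, show q - 1 + h = q + h - 1 by omega]
          rcases iv (q + h - 1) with h5 | h5
          · exact absurd h5.1 hf1
          · rw [cst (q + h - 1) (by omega) (by omega)] at h5
            omega
        · rw [show q - 1 + h = q + h - 1 by omega, show q - 1 + 1 = q by omega]
          rcases iv (q + h - 1) with h5 | h5
          · exact absurd h5.1 hf1
          · rw [cst (q + h - 1) (by omega) (by omega)] at h5
            omega
    · have hdp1 : ¬ h ∣ q - 1 + h := by rwa [hdd]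
      have q2 : q ≠ 1 := by rintro rfl; simp at hd1
      have npl : ¬ Pl h R G q := by
        intro hpl
        refine not_nm dis (show q < q + h by omega) hpl ?_ (hF _ hf)
        intro x hx hx' hm
        by_cases hxx : x + 1 < q + h
        · exact nomi x (by omega) (by omega) hm
        · have : x = q - 1 + h := by omega
          subst this
          have := hR.r1 (q - 1 + h) hm.1 (by
            rw [show q - 1 + h + 1 = q + h by omega]; exact hFR _ hf)
          exact hdp1 this
      have hx := mt plq npl
      push Not at hx
      obtain ⟨x1, x2, x4⟩ := hx
      have y1 := pv (q - 1) (by rw [show q - 1 + 1 = q by omega]; exact hrq) hd1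
      have y2 := W.anti_le (show 1 ≤ q - 1 by omega) (show q - 1 ≤ q by omega)
      have y3 := pv (q - 1 + h) (by
            rw [show q - 1 + h + 1 = q + h by omega]; exact hFR _ hf) hdp1
      rw [cst (q - 1 + h) (by omega) (by omega)] at y3
      refine gap1 (q := q - 1) (by omega) hd1 ?_ ?_
      · rw [show q - 1 + h + 1 = q + h by omega]
        omega
      · omega
  · have cst := W.const (by omega) he
    have hdp : h ∣ q + h := by rwa [hdd]
    rcases iv (q + h) with ⟨hf, h1⟩ | ⟨hf, h1⟩
    swap
    · refine gap2 (q := q) h3 hd ?_ ?_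
      · have := hle (q + h + 1)
        omega
      · have := hle (q + 1)
        have := V.anti_le (show 1 ≤ q + 1 by omega) (show q + 1 ≤ q + h by omega)
        omega
    have hr := hFR _ hf
    have hr1 : R (q + 1) := by
      rw [hR.r3 (q + 1) (by omega), show q + 1 + h = q + h + 1 by omega]
      exact (hR.r2 _ (by omega) hdp).1 hr
    have npl : ¬ Pl h R G (q + 1) := by
      intro hpl
      refine not_nm dis (show q + 1 < q + h by omega) hpl ?_ (hF _ hf)
      rintro x hx hx' ⟨-, p1, -⟩
      rw [cst x (by omega) (by omega), cst (x + 1) (by omega) (by omega)] at p1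
      rcases p1 with p1 | ⟨p0, p1⟩
      · omega
      · have := dvd_near hd p0 (by omega)
        omega
    have q1 : q ≠ 0 := by
      rintro rfl
      refine npl ⟨hr1, Or.inr ?_, Or.inl rfl⟩
      rw [cst (0 + 1) (by omega) (by omega), cst (0 + 1 + 1) (by omega) (by omega)]
    have hqh : h ≤ q := Nat.le_of_dvd (by omega) hd
    have x3 : ¬ (G (q + 1) < G (q - 1)) := by
      intro hlt
      refine npl ⟨hr1, Or.inr ?_, Or.inr (Or.inr ⟨by simpa using hd, ?_⟩)⟩
      · rw [cst (q + 1) (by omega) (by omega), cst (q + 1 + 1) (by omega) (by omega)]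
      · rw [show q + 1 - 2 = q - 1 by omega]; exact hlt
    have hrq : R q := (hR.r3 q (by omega)).2 hr
    have hdq1 : ¬ h ∣ q - 1 := fun hh => by
      have := d1 _ hh
      rw [show q - 1 + 1 = q by omega] at this
      exact this hd
    have y1 := pv (q - 1) (by rw [show q - 1 + 1 = q by omega]; exact hrq) hdq1
    have y2 := W.anti_le (show 1 ≤ q - 1 by omega) (show q - 1 ≤ q + 1 by omega)
    have y3 := pv (q - 1 + h) (by
            rw [show q - 1 + h + 1 = q + h by omega]; exact hr) (by rwa [hdd])
    rw [cst (q - 1 + h) (by omega) (by omega)] at y3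
    refine gap1 (q := q - 1) (by omega) hdq1 ?_ ?_
    · rw [show q - 1 + h + 1 = q + h by omega]
      omega
    · omega
end SigP
namespace SigP
open Finset

theorem first_k {α : Type*} [LinearOrder α] (s : Finset α) :
    ∀ k, k ≤ s.card → (s.filter (fun c => (s.filter (fun d => d ≤ c)).card ≤ k)).card = k := by
  induction s using Finset.induction_on_max with
  | empty => intro k hk; simp at hk; simp [hk]
  | insert a s ha ih =>
    intro k hk
    have has : a ∉ s := fun h => lt_irrefl _ (ha a h)
    have hca : ((insert a s).filter (fun d => d ≤ a)) = insert a s := by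
      apply filter_true_of_mem
      intro x hx
      rcases mem_insert.1 hx with h | h
      · exact h.le
      · exact (ha x h).le
    have hcs : ∀ c ∈ s, ((insert a s).filter (fun d => d ≤ c)) = s.filter (fun d => d ≤ c) := by
      intro c hc
      rw [filter_insert, if_neg (not_le.2 (ha c hc))]
    rw [card_insert_of_notMem has] at hk
    rcases Nat.eq_or_lt_of_le hk with h | h
    · rw [filter_true_of_mem, card_insert_of_notMem has, h]
      intro c _
      refine (card_filter_le _ _).trans ?_
      rw [card_insert_of_notMem has, h]
    · rw [filter_insert, if_neg]
      · rw [filter_congr (q := fun c => (s.filter (fun d => d ≤ c)).card ≤ k)]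
        · exact ih k (by omega)
        · intro c hc
          rw [hcs c hc]
      · rw [hca, card_insert_of_notMem has]; omega

theorem first_k_le (P : ℕ → Prop) (hP : {c | P c}.Finite) (k : ℕ) (hk : k ≤ {c | P c}.ncard) :
    {c | P c ∧ {d | P d ∧ d ≤ c}.ncard ≤ k}.ncard = k := by
  classical
  have e : ∀ c, {d | P d ∧ d ≤ c} = ((hP.toFinset.filter (fun d => d ≤ c) : Finset ℕ) : Set ℕ) := by
    intro c; ext d; simp
  have e' : {c | P c ∧ {d | P d ∧ d ≤ c}.ncard ≤ k} =
    ((hP.toFinset.filter (fun c => (hP.toFinset.filter (fun d => d ≤ c)).card ≤ k) : Finset ℕ) : Set ℕ) := by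
    ext c
    rw [Set.mem_ofPred_eq, e, Set.ncard_coe_finset]; simp
  rw [e', Set.ncard_coe_finset]
  apply first_k
  rwa [Set.ncard_eq_toFinset_card _ hP] at hk

theorem first_k_ge (P : ℕ → Prop) (hP : {c | P c}.Finite) (k : ℕ) (hk : k ≤ {c | P c}.ncard) :
    {c | P c ∧ {d | P d ∧ c ≤ d}.ncard ≤ k}.ncard = k := by
  classical
  have e : ∀ c, {d | P d ∧ c ≤ d} = ((hP.toFinset.filter (fun d => c ≤ d) : Finset ℕ) : Set ℕ) := by
    intro c; ext d; simp
  have e' : {c | P c ∧ {d | P d ∧ c ≤ d}.ncard ≤ k} =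
    ((hP.toFinset.filter (fun c => (hP.toFinset.filter (fun d => c ≤ d)).card ≤ k) : Finset ℕ) : Set ℕ) := by
    ext c
    rw [Set.mem_ofPred_eq, e, Set.ncard_coe_finset]; simp
  rw [e', Set.ncard_coe_finset]
  refine first_k (α := ℕᵒᵈ) hP.toFinset k ?_
  rwa [Set.ncard_eq_toFinset_card _ hP] at hk

noncomputable def cntN (p m : ℕ → Prop) : ℕ := {c | Nm p m c}.ncard
noncomputable def cntC (p m : ℕ → Prop) : ℕ := {c | Cn p m c}.ncard

def FC (p m : ℕ → Prop) (c : ℕ) : Prop :=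
  Cn p m c ∧ {d | Cn p m d ∧ d ≤ c}.ncard ≤ cntC p m - cntN p m
def FN (p m : ℕ → Prop) (c : ℕ) : Prop :=
  Nm p m c ∧ {d | Nm p m d ∧ c ≤ d}.ncard ≤ cntN p m - cntC p m

open Classical in
noncomputable def psiC (h : ℕ) (R : ℕ → Prop) (H : ℕ → ℕ) (c : ℕ) : ℕ :=
  if cntN (Pl h R H) (Mi h R H) ≤ cntC (Pl h R H) (Mi h R H) then
    H c + ind (FC (Pl h R H) (Mi h R H)) c
  else H c - ind (FN (Pl h R H) (Mi h R H)) c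

theorem FC_init {p m : ℕ → Prop} (hfC : {c | Cn p m c}.Finite) (c f : ℕ) (hf : FC p m f)
    (hc : Cn p m c) (hcf : c ≤ f) : FC p m c := by
  refine ⟨hc, le_trans (Set.ncard_le_ncard ?_ (hfC.subset ?_)) hf.2⟩
  · rintro d ⟨h1, h2⟩; exact ⟨h1, h2.trans hcf⟩
  · rintro d ⟨h1, -⟩; exact h1

theorem FN_fin {p m : ℕ → Prop} (hfN : {c | Nm p m c}.Finite) (c f : ℕ) (hf : FN p m f)
    (hc : Nm p m c) (hcf : f ≤ c) : FN p m c := by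
  refine ⟨hc, le_trans (Set.ncard_le_ncard ?_ (hfN.subset ?_)) hf.2⟩
  · rintro d ⟨h1, h2⟩; exact ⟨h1, hcf.trans h2⟩
  · rintro d ⟨h1, -⟩; exact h1

/-- the flip by addition, assembled -/
theorem core_add {h : ℕ} {R F : ℕ → Prop} {H G : ℕ → ℕ} (hR : RH h R) (V : Vd h H)
    (iv : ∀ c, (F c ∧ G c = H c + 1) ∨ (¬ F c ∧ G c = H c))
    (hF : ∀ c, F c → Cn (Pl h R H) (Mi h R H) c)
    (hin : ∀ c f, F f → Cn (Pl h R H) (Mi h R H) c → c ≤ f → F c) :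
    Vd h G ∧ (∀ c, Nm (Pl h R G) (Mi h R G) c ↔ Nm (Pl h R H) (Mi h R H) c ∨ F c) ∧
    (∀ c, Cn (Pl h R G) (Mi h R G) c ↔ Cn (Pl h R H) (Mi h R H) c ∧ ¬ F c) ∧
    ((∃ p, Gap h G p) ↔ ∃ p, Gap h H p) := by
  have dis := pm_dis (H := H) hR
  have hFp : ∀ c, F c → Pl h R H c := fun c hc => (hF c hc).1
  have hcl : ∀ c, 1 ≤ c → h ∣ c → F (c + 1) → Pl h R H c → F c := fun c _ _ hf hp =>
    hin c (c + 1) hf (cn_adj dis hp (hF _ hf)) (Nat.le_succ c)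
  have W := flip_vd_add hR V iv hFp hcl
  have fl := flip_add dis hF hin (flip_pl_add hR V iv hFp hcl) (flip_mi_add hR V iv hFp hcl)
  refine ⟨W, fun c => (fl c).1, fun c => (fl c).2, ?_, ?_⟩
  · exact gap_bwd hR V W iv (fun c hc => (fl c).1.2 (Or.inr hc))
  · exact gap_fwd hR V W iv hF

theorem core_sub {h : ℕ} {R F : ℕ → Prop} {H G : ℕ → ℕ} (hR : RH h R) (V : Vd h G)
    (iv : ∀ c, (F c ∧ G c = H c + 1) ∨ (¬ F c ∧ G c = H c))
    (hF : ∀ c, F c → Nm (Pl h R G) (Mi h R G) c)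
    (hin : ∀ c f, F f → Nm (Pl h R G) (Mi h R G) c → f ≤ c → F c) :
    Vd h H ∧ (∀ c, Nm (Pl h R H) (Mi h R H) c ↔ Nm (Pl h R G) (Mi h R G) c ∧ ¬ F c) ∧
    (∀ c, Cn (Pl h R H) (Mi h R H) c ↔ Cn (Pl h R G) (Mi h R G) c ∨ F c) ∧
    ((∃ p, Gap h H p) ↔ ∃ p, Gap h G p) := by
  have dis := pm_dis (H := G) hR
  have hFp : ∀ c, F c → Mi h R G c := fun c hc => (hF c hc).1
  have hcl : ∀ c, 1 ≤ c → h ∣ c → F c → Mi h R G (c + 1) → F (c + 1) := fun c _ _ hf hp =>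
    hin (c + 1) c hf (nm_adj dis hp (hF _ hf)) (Nat.le_succ c)
  have W := flip_vd_sub hR V iv hFp hcl
  have fl := flip_sub dis hF hin (flip_pl_sub hR V iv hFp hcl) (flip_mi_sub hR V iv hFp hcl)
  refine ⟨W, fun c => (fl c).1, fun c => (fl c).2, ?_, ?_⟩
  · exact gap_fwd hR W V iv (fun c hc => (fl c).2.2 (Or.inr hc))
  · exact gap_bwd hR W V iv hF

theorem Mi_pos {h : ℕ} {R : ℕ → Prop} {H : ℕ → ℕ} {c : ℕ} (hm : Mi h R H c) : 1 ≤ H c := by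
  obtain ⟨-, h1, -⟩ := hm
  omega

theorem psiC_main {h : ℕ} {R : ℕ → Prop} {H : ℕ → ℕ} (hR : RH h R) (V : Vd h H)
    (hfC : {c | Cn (Pl h R H) (Mi h R H) c}.Finite)
    (hfN : {c | Nm (Pl h R H) (Mi h R H) c}.Finite) :
    Vd h (psiC h R H) ∧ psiC h R (psiC h R H) = H ∧
    ((∃ p, Gap h (psiC h R H) p) ↔ ∃ p, Gap h H p) := by
  have dis := pm_dis (H := H) hR
  by_cases hle : cntN (Pl h R H) (Mi h R H) ≤ cntC (Pl h R H) (Mi h R H)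
  · set F := FC (Pl h R H) (Mi h R H) with hFdef
    have hG : psiC h R H = fun c => H c + ind F c := by
      funext c; unfold psiC; rw [if_pos hle]
    have iv : ∀ c, (F c ∧ psiC h R H c = H c + 1) ∨ (¬ F c ∧ psiC h R H c = H c) := by
      intro c
      rw [hG]
      by_cases hc : F c
      · exact Or.inl ⟨hc, by simp [ind_pos hc]⟩
      · exact Or.inr ⟨hc, by simp [ind_neg hc]⟩
    have hF : ∀ c, F c → Cn (Pl h R H) (Mi h R H) c := fun c hc => hc.1
    obtain ⟨W, hN', hC', hgap⟩ := core_add hR V iv hF (FC_init hfC)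
    refine ⟨W, ?_, hgap⟩
    generalize psiC h R H = G at *
    have hfF : {c | F c}.Finite := hfC.subset hF
    have cF : {c | F c}.ncard = cntC (Pl h R H) (Mi h R H) - cntN (Pl h R H) (Mi h R H) :=
      first_k_le _ hfC _ (Nat.sub_le _ _)
    have cN : cntN (Pl h R G) (Mi h R G) = cntC (Pl h R H) (Mi h R H) := by
      have : {c | Nm (Pl h R G) (Mi h R G) c} = {c | Nm (Pl h R H) (Mi h R H) c} ∪ {c | F c} := by
        ext c; exact hN' c
      unfold cntN at *
      rw [this, Set.ncard_union_eq _ hfN hfF, cF]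
      · omega
      · rw [Set.disjoint_left]
        intro c h1 h2
        exact dis c (hF c h2).1 h1.1
    have cC : cntC (Pl h R G) (Mi h R G) = cntN (Pl h R H) (Mi h R H) := by
      have : {c | Cn (Pl h R G) (Mi h R G) c} = {c | Cn (Pl h R H) (Mi h R H) c} \ {c | F c} := by
        ext c; exact hC' c
      unfold cntC at *
      rw [this, Set.ncard_sdiff (show {c | F c} ⊆ {c | Cn (Pl h R H) (Mi h R H) c} from hF) hfF, cF]
      omega
    rcases Nat.eq_or_lt_of_le hle with heq | hlt
    · have hno : ∀ c, ¬ F c := by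
        intro c hc
        rw [heq, Nat.sub_self, Set.ncard_eq_zero hfF] at cF
        have : c ∈ {c | F c} := hc
        rw [cF] at this
        exact this
      have : G = H := by
        funext c
        have := iv c
        have := hno c
        tauto
      rw [this]
      funext c
      unfold psiC
      rw [if_pos hle, ind_neg (hno c), Nat.add_zero]
    · funext c
      unfold psiC
      rw [if_neg (by omega)]
      have key : FN (Pl h R G) (Mi h R G) c ↔ F c := by
        unfold FN
        rw [cN, cC, ← cF]
        constructor
        · rintro ⟨h1, h2⟩
          by_contra hcF
          have h1' := ((hN' c).1 h1).resolve_right hcF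
          have hsub : insert c {c | F c} ⊆ {d | Nm (Pl h R G) (Mi h R G) d ∧ c ≤ d} := by
            intro d hd
            rcases hd with rfl | hd
            · exact ⟨h1, le_rfl⟩
            · exact ⟨(hN' d).2 (Or.inr hd), (nm_lt_cn dis h1' (hF d hd)).le⟩
          have h5 := Set.ncard_le_ncard hsub ((hfN.union hfF).subset (by
            rintro d ⟨h6, -⟩; exact (hN' d).1 h6))
          rw [Set.ncard_insert_of_notMem (by exact hcF) hfF] at h5
          omega
        · intro hc
          refine ⟨(hN' c).2 (Or.inr hc), Set.ncard_le_ncard ?_ hfF⟩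
          rintro d ⟨h1, h2⟩
          rcases (hN' d).1 h1 with h3 | h3
          · have := nm_lt_cn dis h3 (hF c hc); omega
          · exact h3
      have := iv c
      by_cases hc : F c
      · rw [ind_pos (key.2 hc)]
        have : G c = H c + 1 := by tauto
        omega
      · rw [ind_neg (fun hx => hc (key.1 hx))]
        have : G c = H c := by tauto
        omega
  · set F := FN (Pl h R H) (Mi h R H) with hFdef
    have hG : psiC h R H = fun c => H c - ind F c := by
      funext c; unfold psiC; rw [if_neg hle]
    have hF : ∀ c, F c → Nm (Pl h R H) (Mi h R H) c := fun c hc => hc.1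
    have iv : ∀ c, (F c ∧ H c = psiC h R H c + 1) ∨ (¬ F c ∧ H c = psiC h R H c) := by
      intro c
      rw [hG]
      by_cases hc : F c
      · refine Or.inl ⟨hc, ?_⟩
        have := Mi_pos (hF c hc).1
        simp only [ind_pos hc]; omega
      · exact Or.inr ⟨hc, by simp [ind_neg hc]⟩
    obtain ⟨W, hN', hC', hgap⟩ := core_sub hR V iv hF (FN_fin hfN)
    refine ⟨W, ?_, hgap⟩
    generalize psiC h R H = G at *
    have hfF : {c | F c}.Finite := hfN.subset hF
    have cF : {c | F c}.ncard = cntN (Pl h R H) (Mi h R H) - cntC (Pl h R H) (Mi h R H) :=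
      first_k_ge _ hfN _ (Nat.sub_le _ _)
    have cC : cntC (Pl h R G) (Mi h R G) = cntN (Pl h R H) (Mi h R H) := by
      have : {c | Cn (Pl h R G) (Mi h R G) c} = {c | Cn (Pl h R H) (Mi h R H) c} ∪ {c | F c} := by
        ext c; exact hC' c
      unfold cntC at *
      rw [this, Set.ncard_union_eq _ hfC hfF, cF]
      · omega
      · rw [Set.disjoint_left]
        intro c h1 h2
        exact dis c h1.1 (hF c h2).1
    have cN : cntN (Pl h R G) (Mi h R G) = cntC (Pl h R H) (Mi h R H) := by
      have : {c | Nm (Pl h R G) (Mi h R G) c} = {c | Nm (Pl h R H) (Mi h R H) c} \ {c | F c} := by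
        ext c; exact hN' c
      unfold cntN at *
      rw [this, Set.ncard_sdiff (show {c | F c} ⊆ {c | Nm (Pl h R H) (Mi h R H) c} from hF) hfF, cF]
      omega
    funext c
    unfold psiC
    rw [if_pos (by omega)]
    have key : FC (Pl h R G) (Mi h R G) c ↔ F c := by
      unfold FC
      rw [cN, cC, ← cF]
      constructor
      · rintro ⟨h1, h2⟩
        by_contra hcF
        have h1' := ((hC' c).1 h1).resolve_right hcF
        have hsub : insert c {c | F c} ⊆ {d | Cn (Pl h R G) (Mi h R G) d ∧ d ≤ c} := by
          intro d hd
          rcases hd with rfl | hd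
          · exact ⟨h1, le_rfl⟩
          · exact ⟨(hC' d).2 (Or.inr hd), (nm_lt_cn dis (hF d hd) h1').le⟩
        have h5 := Set.ncard_le_ncard hsub ((hfC.union hfF).subset (by
          rintro d ⟨h6, -⟩; exact (hC' d).1 h6))
        rw [Set.ncard_insert_of_notMem (by exact hcF) hfF] at h5
        omega
      · intro hc
        refine ⟨(hC' c).2 (Or.inr hc), Set.ncard_le_ncard ?_ hfF⟩
        rintro d ⟨h1, h2⟩
        rcases (hC' d).1 h1 with h3 | h3
        · have := nm_lt_cn dis (hF c hc) h3; omega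
        · exact h3
    have := iv c
    by_cases hc : F c
    · rw [ind_pos (key.2 hc)]
      have : H c = G c + 1 := by tauto
      omega
    · rw [ind_neg (fun hx => hc (key.1 hx))]
      have : H c = G c := by tauto
      omega

end SigP
namespace SigP
open BPartition

def Rr (h i : ℕ) (c : ℕ) : Prop := 1 ≤ c ∧ colRes h c = i

theorem colRes_eq {h c : ℕ} (h3 : 3 ≤ h) (hc : 1 ≤ c) :
    colRes h c = if c % h = 0 then 0 else min (c % h - 1) (h - c % h) := by
  unfold colRes
  have hlt : c % h < h := Nat.mod_lt _ (by omega)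
  split_ifs with h0
  · rw [h0]; simp
  · have e : c = (c % h - 1) + 1 + h * (c / h) := by
      have := Nat.mod_add_div c h; omega
    have e1 : (c - 1) % h = c % h - 1 := by
      have : c - 1 = (c % h - 1) + h * (c / h) := by omega
      rw [this, Nat.add_mul_mod_self_left, Nat.mod_eq_of_lt (by omega)]
    have e2 : (h - c % h) % h = h - c % h := Nat.mod_eq_of_lt (by omega)
    rw [e1, e2]

theorem succ_mod {h c : ℕ} (h3 : 3 ≤ h) :
    (c % h + 1 < h ∧ (c + 1) % h = c % h + 1) ∨ (c % h + 1 = h ∧ (c + 1) % h = 0) := by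
  have hlt : c % h < h := Nat.mod_lt _ (by omega)
  have e : (c + 1) % h = (c % h + 1) % h := by simp [Nat.add_mod]
  rcases Nat.lt_or_ge (c % h + 1) h with h1 | h1
  · left; exact ⟨h1, by rw [e, Nat.mod_eq_of_lt h1]⟩
  · right
    have : c % h + 1 = h := by omega
    exact ⟨this, by rw [e, this, Nat.mod_self]⟩

theorem Rr_RH {n h i : ℕ} (hn : 1 ≤ n) (hh : h = 2 * n + 1) : RH h (Rr h i) := by
  have h3 : 3 ≤ h := by omega
  refine ⟨h3, fun c hc => hc.1, ?_, ?_, ?_⟩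
  · rintro c ⟨hc, h1⟩ ⟨-, h2⟩
    rw [colRes_eq h3 hc] at h1
    rw [colRes_eq h3 (by omega)] at h2
    rw [Nat.dvd_iff_mod_eq_zero]
    by_contra h0
    rw [if_neg h0] at h1
    rcases succ_mod (c := c) h3 with ⟨a, b⟩ | ⟨a, b⟩
    · rw [b, if_neg (by omega)] at h2
      omega
    · rw [b, if_pos rfl] at h2
      omega
  · intro c hc hd
    unfold Rr
    rw [colRes_eq h3 hc, colRes_eq h3 (show 1 ≤ c + 1 by omega)]
    rw [Nat.dvd_iff_mod_eq_zero] at hd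
    rcases succ_mod (c := c) h3 with ⟨a, b⟩ | ⟨a, b⟩
    · rw [b, hd]; simp; omega
    · omega
  · intro c hc
    unfold Rr
    rw [colRes_eq h3 hc, colRes_eq h3 (show 1 ≤ c + h by omega), Nat.add_mod_right]
    omega

noncomputable def colH (lam : BPartition) (c : ℕ) : ℕ := sInf {r | lam.parts r < c}

theorem parts_anti (lam : BPartition) : Antitone lam.parts := antitone_nat_of_succ_le lam.antitone

theorem colH_zero (lam : BPartition) : colH lam 0 = 0 := by simp [colH]

theorem lt_colH (lam : BPartition) {r c : ℕ} (hc : 1 ≤ c) : r < colH lam c ↔ c ≤ lam.parts r := by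
  have hne : {r | lam.parts r < c}.Nonempty := by
    obtain ⟨r, hr⟩ := Infinite.exists_notMem_finset lam.parts.support
    refine ⟨r, ?_⟩
    have : lam.parts r = 0 := by simpa using hr
    show lam.parts r < c
    omega
  constructor
  · intro hr
    by_contra hcon
    exact absurd (Nat.sInf_le (show r ∈ {r | lam.parts r < c} from not_le.1 hcon)) (not_le.2 hr)
  · intro hr
    by_contra hcon
    have h1 : lam.parts (colH lam c) < c := Nat.sInf_mem hne
    have h2 := parts_anti lam (not_lt.1 hcon)
    omega

theorem mem_diagram (lam : BPartition) (x : ℕ × ℕ) :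
    x ∈ diagram lam ↔ 1 ≤ x.2 ∧ x.1 < colH lam x.2 := by
  constructor
  · rintro ⟨h1, h2⟩; exact ⟨h1, (lt_colH lam h1).2 h2⟩
  · rintro ⟨h1, h2⟩; exact ⟨h1, (lt_colH lam h1).1 h2⟩

theorem colH_eq_of {mu : BPartition} {G : ℕ → ℕ} (h0 : G 0 = 0)
    (hd : ∀ x : ℕ × ℕ, x ∈ diagram mu ↔ 1 ≤ x.2 ∧ x.1 < G x.2) : colH mu = G := by
  funext c
  rcases Nat.eq_zero_or_pos c with h | h
  · subst h; rw [colH_zero, h0]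
  · have key : ∀ r, r < colH mu c ↔ r < G c := by
      intro r
      have := (mem_diagram mu (r, c)).symm.trans (hd (r, c))
      simpa [show 1 ≤ c from h] using this
    have h1 := key (colH mu c)
    have h2 := key (G c)
    omega

theorem ext_colH {lam mu : BPartition} (he : colH lam = colH mu) : lam = mu := by
  have key : ∀ r, lam.parts r = mu.parts r := by
    intro r
    have k : ∀ c, 1 ≤ c → (c ≤ lam.parts r ↔ c ≤ mu.parts r) := by
      intro c hc
      rw [← lt_colH lam hc, ← lt_colH mu hc, he]
    have h1 := k (lam.parts r)
    have h2 := k (mu.parts r)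
    omega
  cases lam; cases mu
  congr
  exact Finsupp.ext key

theorem colH_bdd (lam : BPartition) : ∃ L, ∀ c, L < c → colH lam c = 0 := by
  refine ⟨lam.parts 0, fun c hc => ?_⟩
  by_contra h
  have := (lt_colH lam (show 1 ≤ c by omega)).1 (Nat.pos_of_ne_zero h)
  omega

theorem colH_anti (lam : BPartition) (c : ℕ) (hc : 1 ≤ c) : colH lam (c + 1) ≤ colH lam c := by
  by_contra h
  have h1 := (lt_colH lam (show 1 ≤ c + 1 by omega)).1 (not_le.1 h)
  have h2 := (lt_colH lam hc).2 (show c ≤ lam.parts (colH lam c) by omega)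
  omega

theorem hstrict_iff (h : ℕ) (lam : BPartition) : IsHStrict h lam ↔ Vd h (colH lam) := by
  constructor
  · intro hs
    refine ⟨colH_anti lam, ?_⟩
    intro c hc hd
    by_contra hcon
    have h1 := (lt_colH lam hc (r := colH lam (c + 1) + 1)).1 (by omega)
    have h2 : ¬ c + 1 ≤ lam.parts (colH lam (c + 1)) := fun hx =>
      lt_irrefl _ ((lt_colH lam (by omega)).2 hx)
    have h3 := lam.antitone (colH lam (c + 1))
    have h4 : lam.parts (colH lam (c + 1)) = c := by omega
    rcases hs (colH lam (c + 1)) with h5 | h5 | h5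
    · omega
    · rw [h4] at h5; exact hd h5.2
    · omega
  · intro V r
    by_contra hcon
    push Not at hcon
    obtain ⟨h1, h2, h3⟩ := hcon
    have h4 := V.str (lam.parts r) (by omega) (h2 (by omega))
    have h5 := (lt_colH lam (r := r + 1) (c := lam.parts r) (by omega)).2 (by omega)
    have h6 : ¬ r < colH lam (lam.parts r + 1) := by
      rw [lt_colH lam (by omega)]; omega
    omega

theorem exists_of_Vd {h : ℕ} {G : ℕ → ℕ} (V : Vd h G) (h0 : G 0 = 0)
    (hL : ∃ L, ∀ c, L < c → G c = 0) : ∃ mu : BPartition, colH mu = G ∧ IsHStrict h mu := by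
  classical
  obtain ⟨L, hL⟩ := hL
  let P : ℕ → ℕ → Prop := fun r c => c = 0 ∨ r < G c
  have key : ∀ r c, 1 ≤ c → (c ≤ Nat.findGreatest (P r) L ↔ r < G c) := by
    intro r c hc
    constructor
    · intro hx
      have h1 : P r (Nat.findGreatest (P r) L) :=
        Nat.findGreatest_spec (P := P r) (Nat.zero_le L) (Or.inl rfl)
      rcases h1 with h1 | h1
      · omega
      · exact lt_of_lt_of_le h1 (V.anti_le hc hx)
    · intro hx
      refine Nat.le_findGreatest ?_ (Or.inr hx)
      by_contra hcon
      have := hL c (by omega)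
      omega
  let f : ℕ →₀ ℕ := Finsupp.onFinset (Finset.range (G 1)) (fun r => Nat.findGreatest (P r) L) (by
    intro r hr
    rw [Finset.mem_range]
    exact (key r 1 le_rfl).1 (Nat.pos_of_ne_zero hr))
  have hf : ∀ r, f r = Nat.findGreatest (P r) L := fun r => rfl
  let mu : BPartition := ⟨f, by
    intro r
    rw [hf, hf]
    by_contra hcon
    have h1 := (key (r + 1) (Nat.findGreatest (P (r + 1)) L) (by omega)).1 le_rfl
    have h2 := (key r (Nat.findGreatest (P (r + 1)) L) (by omega)).2 (by omega)
    omega⟩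
  have hc : colH mu = G := by
    apply colH_eq_of h0
    intro x
    constructor
    · rintro ⟨h1, h2⟩
      exact ⟨h1, (key _ _ h1).1 h2⟩
    · rintro ⟨h1, h2⟩
      exact ⟨h1, (key _ _ h1).2 h2⟩
  exact ⟨mu, hc, by rw [hstrict_iff, hc]; exact V⟩

theorem restricted_iff (h : ℕ) (h3 : 3 ≤ h) (lam : BPartition) :
    IsRestricted h lam ↔ ¬ ∃ p, Gap h (colH lam) p := by
  rw [← not_iff_not, not_not]
  constructor
  · intro hr
    unfold IsRestricted at hr
    push Not at hr
    obtain ⟨r, h1, h2⟩ := hr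
    have anti : ∀ a b, 1 ≤ a → a ≤ b → colH lam b ≤ colH lam a := by
      intro a b ha hab
      induction b, hab using Nat.le_induction with
      | base => exact le_rfl
      | succ b hb ih => exact (colH_anti lam b (by omega)).trans ih
    have a1 := (lt_colH lam (r := r) (c := lam.parts r) (by omega)).2 le_rfl
    have a2 : ¬ r < colH lam (lam.parts r + 1) := by rw [lt_colH lam (by omega)]; omega
    have a3 : ¬ r + 1 < colH lam (lam.parts (r + 1) + 1) := by rw [lt_colH lam (by omega)]; omega
    refine ⟨lam.parts r, by omega, by omega, ?_⟩
    by_cases hd : h ∣ lam.parts r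
    · right
      refine ⟨hd, ?_⟩
      have b1 := anti (lam.parts (r + 1) + 1) (lam.parts r - h + 1) (by omega) (by omega)
      have b2 := anti (lam.parts r - h + 1) (lam.parts r) (by omega) (by omega)
      omega
    · left
      have hlt : lam.parts (r + 1) + h < lam.parts r := by
        rcases Nat.eq_or_lt_of_le h1 with h4 | h4
        · exact absurd (h2 h4) hd
        · exact h4
      have b1 := anti (lam.parts (r + 1) + 1) (lam.parts r - h) (by omega) (by omega)
      have b2 := anti (lam.parts r - h) (lam.parts r) (by omega) (by omega)
      exact ⟨hd, by omega, by omega⟩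
  · rintro ⟨p, hp0, hp1, hp2⟩ hr
    have a1 := (lt_colH lam (r := colH lam p - 1) (c := p) hp0).1 (by omega)
    have a2 : ¬ p + 1 ≤ lam.parts (colH lam p - 1) := by rw [← lt_colH lam (by omega)]; omega
    have a3 : lam.parts (colH lam p - 1) = p := by omega
    have a4 := hr (colH lam p - 1)
    rw [a3, show colH lam p - 1 + 1 = colH lam p by omega] at a4
    rcases hp2 with ⟨hd, hlt, he⟩ | ⟨hd, he⟩
    · have b1 : ¬ p - h ≤ lam.parts (colH lam p) := by
        rw [← lt_colH lam (by omega), he]; omega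
      omega
    · have b1 : ¬ p - h + 1 ≤ lam.parts (colH lam p) := by
        rw [← lt_colH lam (by omega), he]; omega
      have := Nat.le_of_dvd hp0 hd
      have : ¬ (lam.parts (colH lam p) + h = p ∧ ¬ h ∣ p) := fun hx => hx.2 hd
      omega
end SigP
namespace SigP
open BPartition

theorem add_core {h : ℕ} {R : ℕ → Prop} {H K : ℕ → ℕ} (hR : RH h R) (V : Vd h H) (W : Vd h K)
    (heq : ∀ c, 1 ≤ c → ¬ R c → K c = H c)
    {c : ℕ} (hc : R c) (hlt : H c < K c) : K c = H c + 1 ∧ Pl h R H c := by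
  have h3 := hR.h3
  have c1 := hR.pos c hc
  have hb : K c = H c + 1 := by
    by_cases hd : h ∣ c
    · have := Nat.le_of_dvd c1 hd
      obtain ⟨e, rfl⟩ : ∃ e, c = e + 1 := ⟨c - 1, by omega⟩
      have nd : ¬ h ∣ e := fun x => dvd_succ_not h3 x hd
      have nR : ¬ R e := fun x => nd (hR.r1 e x hc)
      have a1 := W.anti e (by omega)
      have a2 := heq e (by omega) nR
      have a3 := V.str e (by omega) nd
      omega
    · have nR : ¬ R (c + 1) := fun x => hd (hR.r1 c hc x)
      have a1 := W.str c c1 hd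
      have a2 := heq (c + 1) (by omega) nR
      have a3 := V.anti c c1
      omega
  refine ⟨hb, hc, ?_, ?_⟩
  · by_cases hd : h ∣ c
    · exact Or.inl hd
    · right
      have nR : ¬ R (c + 1) := fun x => hd (hR.r1 c hc x)
      have a1 := W.str c c1 hd
      have a2 := heq (c + 1) (by omega) nR
      omega
  · rcases Nat.lt_or_ge 1 c with h1 | h1
    · right
      obtain ⟨e, rfl⟩ : ∃ e, c = e + 1 := ⟨c - 1, by omega⟩
      have a1 := W.anti e (by omega)
      by_cases hRe : R e
      · right
        have hd := hR.r1 e hRe hc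
        have := Nat.le_of_dvd (by omega) hd
        obtain ⟨f, rfl⟩ : ∃ f, e = f + 1 := ⟨e - 1, by omega⟩
        have nR : ¬ R f := fun x => dvd_succ_not h3 (hR.r1 f x hRe) hd
        have a2 := W.anti f (by omega)
        have a3 := heq f (by omega) nR
        refine ⟨hd, ?_⟩
        show H (f + 1 + 1) < H f
        omega
      · left
        have a3 := heq e (by omega) hRe
        show H (e + 1) < H e
        omega
    · left; omega

theorem sub_core {h : ℕ} {R : ℕ → Prop} {H K : ℕ → ℕ} (hR : RH h R) (V : Vd h H) (W : Vd h K)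
    (heq : ∀ c, 1 ≤ c → ¬ R c → K c = H c)
    {c : ℕ} (hc : R c) (hlt : K c < H c) : K c + 1 = H c ∧ Mi h R H c := by
  have h3 := hR.h3
  have c1 := hR.pos c hc
  have hb : K c + 1 = H c ∧ (h ∣ c - 1 ∨ H (c - 1) ≤ H c) := by
    by_cases hd : h ∣ c - 1
    · have nd : ¬ h ∣ c := fun x => dvd_succ_not h3 hd (by rwa [Nat.sub_add_cancel c1])
      have nR : ¬ R (c + 1) := fun x => nd (hR.r1 c hc x)
      have a1 := V.str c c1 nd
      have a2 := heq (c + 1) (by omega) nR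
      have a3 := W.anti c c1
      exact ⟨by omega, Or.inl hd⟩
    · have c2 : c ≠ 1 := fun x => hd (by simp [x])
      obtain ⟨e, rfl⟩ : ∃ e, c = e + 1 := ⟨c - 1, by omega⟩
      rw [Nat.add_sub_cancel] at hd ⊢
      have nR : ¬ R e := fun x => hd (hR.r1 e x hc)
      have a1 := V.anti e (by omega)
      have a2 := heq e (by omega) nR
      have a3 := W.str e (by omega) hd
      exact ⟨by omega, Or.inr (by omega)⟩
  refine ⟨hb.1, hc, ?_, hb.2⟩
  by_cases hRe : R (c + 1)
  · right
    have hd := hR.r1 c hc hRe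
    have nR : ¬ R (c + 2) := fun x => dvd_succ_not h3 hd (hR.r1 (c + 1) hRe x)
    have a1 := W.anti c c1
    have a2 := W.anti (c + 1) (by omega)
    have a3 := heq (c + 2) (by omega) nR
    rw [show c + 1 + 1 = c + 2 from rfl] at a2
    exact ⟨hd, by omega⟩
  · left
    have a1 := W.anti c c1
    have a3 := heq (c + 1) (by omega) hRe
    omega

theorem Pl_bdd {h : ℕ} {R : ℕ → Prop} {H : ℕ → ℕ} {L : ℕ} (hL : ∀ c, L < c → H c = 0)
    {c : ℕ} (hp : Pl h R H c) : c ≤ L + 2 := by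
  obtain ⟨-, -, h1 | h1 | h1⟩ := hp
  · omega
  · by_contra hc
    rw [hL (c - 1) (by omega)] at h1; omega
  · by_contra hc
    have := h1.2
    rw [hL (c - 2) (by omega)] at this; omega

theorem addable_iff {h i : ℕ} (hR : RH h (Rr h i)) {lam : BPartition} (V : Vd h (colH lam))
    (x : ℕ × ℕ) :
    Addable h i lam x ↔ Pl h (Rr h i) (colH lam) x.2 ∧ x.1 = colH lam x.2 := by
  obtain ⟨r, c⟩ := x
  constructor
  · rintro ⟨hx, hn, nu, hs, hsub, hin, hres⟩
    rw [hstrict_iff] at hs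
    have hin2 := (mem_diagram nu _).1 hin
    rw [mem_diagram] at hn
    have hc : 1 ≤ c := hin2.1
    have hle : ∀ d, 1 ≤ d → colH lam d ≤ colH nu d := by
      intro d hd
      by_contra hcon
      have := (mem_diagram nu _).1 (hsub ((mem_diagram lam (colH nu d, d)).2 ⟨hd, by simpa using hcon⟩))
      exact lt_irrefl _ this.2
    have heq : ∀ d, 1 ≤ d → ¬ Rr h i d → colH nu d = colH lam d := by
      intro d hd hr
      by_contra hcon
      have := hle d hd
      apply hr
      refine ⟨hd, hres (colH lam d, d) ((mem_diagram _ _).2 ⟨hd, by simp only; omega⟩) ?_⟩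
      rw [mem_diagram]; simp
    simp only at hn hin2 hx ⊢
    have := add_core hR V hs heq (c := c) ⟨hc, hx⟩ (by omega)
    exact ⟨this.2, by omega⟩
  · rintro ⟨hp, hr⟩
    simp only at hp hr
    subst hr
    have c1 : 1 ≤ c := hp.1.1
    set H := colH lam with hH
    let F : ℕ → Prop := fun d => d = c ∨ (d + 1 = c ∧ h ∣ d ∧ Pl h (Rr h i) H d)
    let G : ℕ → ℕ := fun d => H d + ind F d
    have iv : ∀ d, (F d ∧ G d = H d + 1) ∨ (¬ F d ∧ G d = H d) := by
      intro d
      by_cases hF : F d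
      · left; exact ⟨hF, by simp only [G, ind_pos hF]⟩
      · right; exact ⟨hF, by simp only [G, ind_neg hF]; rfl⟩
    have hF : ∀ d, F d → Pl h (Rr h i) H d := by
      rintro d (rfl | hd)
      · exact hp
      · exact hd.2.2
    have VG : Vd h G := by
      apply flip_vd_add hR V iv hF
      rintro d hd1 hd2 (h1 | h1) h2
      · exact Or.inr ⟨h1, hd2, h2⟩
      · exact absurd h1.2.1 (dvd_succ_not hR.h3 hd2)
    obtain ⟨L, hL⟩ := colH_bdd lam
    have G0 : G 0 = 0 := by
      rcases iv 0 with h1 | h1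
      · have := (hF 0 h1.1).1.1; omega
      · rw [h1.2, hH, colH_zero]
    obtain ⟨nu, hnu, hs⟩ := exists_of_Vd VG G0 ⟨L + 2, fun d hd => by
      rcases iv d with h1 | h1
      · have := Pl_bdd hL (hF d h1.1); omega
      · rw [h1.2]; exact hL d (by omega)⟩
    refine ⟨hp.1.2, ?_, nu, hs, ?_, ?_, ?_⟩
    · rw [mem_diagram]; simp [hH]
    · intro y hy
      rw [mem_diagram] at hy ⊢
      rw [hnu]
      refine ⟨hy.1, hy.2.trans_le ?_⟩
      simp only [G, hH]; omega
    · rw [mem_diagram, hnu]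
      refine ⟨c1, ?_⟩
      have : F c := Or.inl rfl
      simp only [G, ind_pos this]; omega
    · intro y hy hy2
      rw [mem_diagram, hnu] at hy
      rw [mem_diagram] at hy2
      rcases iv y.2 with h1 | h1
      · exact (hF _ h1.1).1.2
      · rw [h1.2] at hy
        exact absurd hy hy2

theorem removable_iff {h i : ℕ} (hR : RH h (Rr h i)) {lam : BPartition} (V : Vd h (colH lam))
    (x : ℕ × ℕ) :
    Removable h i lam x ↔ Mi h (Rr h i) (colH lam) x.2 ∧ x.1 = colH lam x.2 - 1 := by
  obtain ⟨r, c⟩ := x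
  constructor
  · rintro ⟨hin, mu, hs, hsub, hn, hres⟩
    have hx := hres _ hin hn
    rw [hstrict_iff] at hs
    have hin2 := (mem_diagram lam _).1 hin
    rw [mem_diagram] at hn
    have hc : 1 ≤ c := hin2.1
    have hle : ∀ d, 1 ≤ d → colH mu d ≤ colH lam d := by
      intro d hd
      by_contra hcon
      have := (mem_diagram lam _).1 (hsub ((mem_diagram mu (colH lam d, d)).2 ⟨hd, by simpa using hcon⟩))
      exact lt_irrefl _ this.2
    have heq : ∀ d, 1 ≤ d → ¬ Rr h i d → colH mu d = colH lam d := by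
      intro d hd hr
      by_contra hcon
      have := hle d hd
      apply hr
      refine ⟨hd, hres (colH mu d, d) ((mem_diagram _ _).2 ⟨hd, by simp only; omega⟩) ?_⟩
      rw [mem_diagram]; simp
    simp only at hn hin2 hx ⊢
    have := sub_core hR V hs heq (c := c) ⟨hc, hx⟩ (by omega)
    exact ⟨this.2, by omega⟩
  · rintro ⟨hp, hr⟩
    simp only at hp hr
    subst hr
    have c1 : 1 ≤ c := hp.1.1
    set H := colH lam with hH
    let F : ℕ → Prop := fun d => d = c ∨ (d = c + 1 ∧ h ∣ c ∧ Mi h (Rr h i) H d)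
    let G : ℕ → ℕ := fun d => H d - ind F d
    have hF : ∀ d, F d → Mi h (Rr h i) H d := by
      rintro d (rfl | hd)
      · exact hp
      · exact hd.2.2
    have iv : ∀ d, (F d ∧ H d = G d + 1) ∨ (¬ F d ∧ H d = G d) := by
      intro d
      by_cases hFd : F d
      · left; 
        have := Mi_pos (hF d hFd)
        exact ⟨hFd, by simp only [G, ind_pos hFd]; omega⟩
      · right; exact ⟨hFd, by simp only [G, ind_neg hFd]; rfl⟩
    have VG : Vd h G := by
      apply flip_vd_sub hR V iv hF
      rintro d hd1 hd2 (h1 | h1) h2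
      · subst h1; exact Or.inr ⟨rfl, hd2, h2⟩
      · rw [h1.1] at hd2
        exact absurd hd2 (dvd_succ_not hR.h3 h1.2.1)
    obtain ⟨L, hL⟩ := colH_bdd lam
    have gle : ∀ d, G d ≤ H d := fun d => Nat.sub_le _ _
    have G0 : G 0 = 0 := by
      have := gle 0; rw [hH, colH_zero] at this; omega
    obtain ⟨mu, hmu, hs⟩ := exists_of_Vd VG G0 ⟨L, fun d hd => by
      have h1 := gle d
      have h2 : H d = 0 := hL d hd
      omega⟩
    have hpos := Mi_pos hp
    refine ⟨?_, mu, hs, ?_, ?_, ?_⟩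
    · rw [mem_diagram]; refine ⟨c1, ?_⟩; simp only [← hH]; omega
    · intro y hy
      rw [mem_diagram] at hy ⊢
      rw [hmu] at hy
      exact ⟨hy.1, hy.2.trans_le (gle _)⟩
    · rw [mem_diagram, hmu]
      have : F c := Or.inl rfl
      simp only [G, ind_pos this]; omega
    · intro y hy hy2
      rw [mem_diagram, hmu] at hy2
      rw [mem_diagram] at hy
      rcases iv y.2 with h1 | h1
      · exact (hF _ h1.1).1.2
      · rw [← hH, h1.2] at hy
        exact absurd hy hy2

theorem ncard_graph (Q : ℕ → Prop) (g : ℕ → ℕ) :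
    {y : ℕ × ℕ | Q y.2 ∧ y.1 = g y.2}.ncard = {c | Q c}.ncard := by
  have : {y : ℕ × ℕ | Q y.2 ∧ y.1 = g y.2} = (fun c => (g c, c)) '' {c | Q c} := by
    ext ⟨a, b⟩
    simp only [Set.mem_ofPred_eq, Set.mem_image, Prod.mk.injEq]
    constructor
    · rintro ⟨h1, h2⟩; exact ⟨b, h1, h2.symm, rfl⟩
    · rintro ⟨c, h1, h2, rfl⟩; exact ⟨h1, h2.symm⟩
  rw [this, Set.ncard_image_of_injective]
  intro a b hab
  exact (Prod.mk.inj hab).2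

theorem ncard_Ct (P : ℕ → Prop) {a b : ℕ} (hab : a ≤ b) :
    ({c | P c ∧ a ≤ c ∧ c < b}.ncard : ℤ) = Ct P b - Ct P a := by
  induction b, hab using Nat.le_induction with
  | base =>
    have : {c | P c ∧ a ≤ c ∧ c < a} = ∅ := by
      ext c; simp
    rw [this]; simp
  | succ b hb ih =>
    have fin : {c | P c ∧ a ≤ c ∧ c < b}.Finite :=
      (Set.finite_lt_nat b).subset (fun c hc => hc.2.2)
    rw [Ct_succ]
    by_cases hP : P b
    · have : {c | P c ∧ a ≤ c ∧ c < b + 1} = insert b {c | P c ∧ a ≤ c ∧ c < b} := by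
        ext c
        simp only [Set.mem_ofPred_eq, Set.mem_insert_iff]
        constructor
        · rintro ⟨h1, h2, h3⟩
          rcases Nat.eq_or_lt_of_le (Nat.le_of_lt_succ h3) with h4 | h4
          · exact Or.inl h4
          · exact Or.inr ⟨h1, h2, h4⟩
        · rintro (rfl | h1)
          · exact ⟨hP, hb, by omega⟩
          · exact ⟨h1.1, h1.2.1, by omega⟩
      rw [this, Set.ncard_insert_of_notMem (by simp) fin, ind_pos hP]
      push_cast; omega
    · have : {c | P c ∧ a ≤ c ∧ c < b + 1} = {c | P c ∧ a ≤ c ∧ c < b} := by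
        ext c
        simp only [Set.mem_ofPred_eq]
        constructor
        · rintro ⟨h1, h2, h3⟩
          rcases Nat.eq_or_lt_of_le (Nat.le_of_lt_succ h3) with h4 | h4
          · subst h4; exact absurd h1 hP
          · exact ⟨h1, h2, h4⟩
        · rintro h1; exact ⟨h1.1, h1.2.1, by omega⟩
      rw [this, ind_neg hP, ih]; simp

theorem Sg_Ct (p m : ℕ → Prop) (c : ℕ) : Sg p m c = Ct p c - Ct m c := by
  unfold Sg Ct; rw [Finset.sum_sub_distrib]

theorem window {Q : ℕ × ℕ → Prop} {P : ℕ → Prop} {g : ℕ → ℕ}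
    (hQ : ∀ y, Q y ↔ P y.2 ∧ y.1 = g y.2) {W : ℕ × ℕ → Prop} {a b : ℕ} (hab : a ≤ b)
    (hW : ∀ c, P c → (W (g c, c) ↔ a ≤ c ∧ c < b)) :
    ({y | Q y ∧ W y}.ncard : ℤ) = Ct P b - Ct P a := by
  rw [← ncard_Ct P hab, ← ncard_graph (fun c => P c ∧ a ≤ c ∧ c < b) g]
  congr 2
  ext ⟨r, c⟩
  simp only [Set.mem_ofPred_eq, hQ]
  constructor
  · rintro ⟨⟨h1, h2⟩, h3⟩
    subst h2
    exact ⟨⟨h1, (hW c h1).1 h3⟩, rfl⟩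
  · rintro ⟨⟨h1, h3⟩, h2⟩
    subst h2
    exact ⟨⟨h1, rfl⟩, (hW c h1).2 h3⟩

theorem normal_iff {h i : ℕ} (hR : RH h (Rr h i)) {lam : BPartition} (V : Vd h (colH lam))
    (x : ℕ × ℕ) :
    Normal h i lam x ↔ Nm (Pl h (Rr h i) (colH lam)) (Mi h (Rr h i) (colH lam)) x.2 ∧
      x.1 = colH lam x.2 - 1 := by
  obtain ⟨r, c⟩ := x
  have hA := addable_iff hR V
  have hB := removable_iff hR V
  have dis := fun c => pm_dis (H := colH lam) hR c
  unfold BPartition.Normal Nm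
  rw [hB]
  simp only
  generalize Pl h (Rr h i) (colH lam) = p at *
  generalize Mi h (Rr h i) (colH lam) = m at *
  generalize colH lam = H at *
  constructor
  · rintro ⟨⟨hm, hr⟩, hw⟩
    refine ⟨⟨hm, ?_⟩, hr⟩
    intro d hd
    have h1 := hw (H d + r, d) (by unfold posLE; simp only; omega)
    have e1 := window hA (W := fun y => posLE (H d + r, d) y ∧ posLE y (r, c)) (a := d) (b := c + 1)
      (by omega) (by
        intro c' hc'
        have hne : c' ≠ c := by rintro rfl; exact dis _ hc' hm
        unfold posLE; simp only
        constructor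
        · omega
        · rintro ⟨h1, h2⟩
          rcases Nat.eq_or_lt_of_le h1 with h3 | h3
          · subst h3; omega
          · omega)
    have e2 := window (g := fun c => H c - 1) hB (W := fun y => posLE (H d + r, d) y ∧ posLE y (r, c)) (a := d) (b := c + 1)
      (by omega) (by
        intro c' hc'
        unfold posLE; simp only
        constructor
        · omega
        · rintro ⟨h1, h2⟩
          refine ⟨?_, ?_⟩
          · rcases Nat.eq_or_lt_of_le h1 with h3 | h3
            · subst h3; omega
            · omega
          · rcases Nat.eq_or_lt_of_le (Nat.le_of_lt_succ h2) with h3 | h3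
            · subst h3; omega
            · omega)
    rw [Sg_Ct, Sg_Ct]
    have h2 : ((Set.ncard {y | Addable h i lam y ∧ posLE (H d + r, d) y ∧ posLE y (r, c)} : ℕ) : ℤ) <
      ((Set.ncard {y | Removable h i lam y ∧ posLE (H d + r, d) y ∧ posLE y (r, c)} : ℕ) : ℤ) := by
      exact_mod_cast h1
    rw [e1, e2] at h2
    omega
  · rintro ⟨⟨hm, hw⟩, hr⟩
    refine ⟨⟨hm, hr⟩, ?_⟩
    rintro ⟨zr, zc⟩ hz
    have hz' : zc < c ∨ (zc = c ∧ r ≤ zr) := hz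
    obtain ⟨d, hdc, hd1, hd2⟩ : ∃ d, d ≤ c ∧
        (∀ c', p c' → (d ≤ c' ↔ (zc < c' ∨ (zc = c' ∧ H c' ≤ zr)))) ∧
        (∀ c', m c' → (d ≤ c' ↔ (zc < c' ∨ (zc = c' ∧ H c' - 1 ≤ zr)))) := by
      by_cases hcase : (p zc ∧ H zc ≤ zr) ∨ (m zc ∧ H zc - 1 ≤ zr)
      · refine ⟨zc, by omega, ?_, ?_⟩
        · intro c' hc'
          constructor
          · intro h1
            rcases Nat.eq_or_lt_of_le h1 with h3 | h3
            · subst h3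
              rcases hcase with h4 | h4
              · exact Or.inr ⟨rfl, h4.2⟩
              · exact absurd h4.1 (dis _ hc')
            · exact Or.inl h3
          · omega
        · intro c' hc'
          constructor
          · intro h1
            rcases Nat.eq_or_lt_of_le h1 with h3 | h3
            · subst h3
              rcases hcase with h4 | h4
              · exact absurd hc' (dis _ h4.1)
              · exact Or.inr ⟨rfl, h4.2⟩
            · exact Or.inl h3
          · omega
      · refine ⟨zc + 1, ?_, ?_, ?_⟩
        · rcases hz' with h1 | h1
          · omega
          · exfalso; apply hcase; right
            rw [h1.1]; exact ⟨hm, by omega⟩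
        · intro c' hc'
          constructor
          · omega
          · rintro (h1 | ⟨rfl, h1⟩)
            · omega
            · exact absurd (Or.inl ⟨hc', h1⟩) hcase
        · intro c' hc'
          constructor
          · omega
          · rintro (h1 | ⟨rfl, h1⟩)
            · omega
            · exact absurd (Or.inr ⟨hc', h1⟩) hcase
    have e1 := window hA (W := fun y => posLE (zr, zc) y ∧ posLE y (r, c)) (a := d) (b := c + 1)
      (by omega) (by
        intro c' hc'
        have hne : c' ≠ c := by rintro rfl; exact dis _ hc' hm
        rw [hd1 c' hc']
        unfold posLE; simp only
        omega)
    have e2 := window (g := fun c => H c - 1) hB (W := fun y => posLE (zr, zc) y ∧ posLE y (r, c)) (a := d) (b := c + 1)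
      (by omega) (by
        intro c' hc'
        rw [hd2 c' hc']
        unfold posLE; simp only
        apply and_congr_right
        intro _
        constructor
        · omega
        · intro h2
          rcases Nat.eq_or_lt_of_le (Nat.le_of_lt_succ h2) with h3 | h3
          · subst h3; omega
          · omega)
    have h2 := hw d hdc
    rw [Sg_Ct, Sg_Ct] at h2
    have h3 : ((Set.ncard {y | Addable h i lam y ∧ posLE (zr, zc) y ∧ posLE y (r, c)} : ℕ) : ℤ) <
      ((Set.ncard {y | Removable h i lam y ∧ posLE (zr, zc) y ∧ posLE y (r, c)} : ℕ) : ℤ) := by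
      rw [e1, e2]; omega
    exact_mod_cast h3

theorem conormal_iff {h i : ℕ} (hR : RH h (Rr h i)) {lam : BPartition} (V : Vd h (colH lam))
    (x : ℕ × ℕ) :
    Conormal h i lam x ↔ Cn (Pl h (Rr h i) (colH lam)) (Mi h (Rr h i) (colH lam)) x.2 ∧
      x.1 = colH lam x.2 := by
  obtain ⟨r, c⟩ := x
  have hA := addable_iff hR V
  have hB := removable_iff hR V
  have dis := fun c => pm_dis (H := colH lam) hR c
  unfold Conormal Cn
  rw [hA]
  simp only
  generalize Pl h (Rr h i) (colH lam) = p at *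
  generalize Mi h (Rr h i) (colH lam) = m at *
  generalize colH lam = H at *
  constructor
  · rintro ⟨⟨hm, hr⟩, hw⟩
    refine ⟨⟨hm, ?_⟩, hr⟩
    intro d hd
    have h1 := hw (0, d) (by unfold posLE; simp only; omega)
    have e1 := window hA (W := fun y => posLE (r, c) y ∧ posLE y (0, d)) (a := c) (b := d + 1)
      (by omega) (by
        intro c' hc'
        unfold posLE; simp only
        constructor
        · omega
        · rintro ⟨h1, h2⟩
          rcases Nat.eq_or_lt_of_le h1 with h3 | h3
          · subst h3; omega
          · omega)
    have e2 := window (g := fun c => H c - 1) hB (W := fun y => posLE (r, c) y ∧ posLE y (0, d)) (a := c) (b := d + 1)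
      (by omega) (by
        intro c' hc'
        have hne : c' ≠ c := by rintro rfl; exact dis _ hm hc'
        unfold posLE; simp only
        omega)
    rw [Sg_Ct, Sg_Ct]
    have h2 : ((Set.ncard {y | Removable h i lam y ∧ posLE (r, c) y ∧ posLE y (0, d)} : ℕ) : ℤ) <
      ((Set.ncard {y | Addable h i lam y ∧ posLE (r, c) y ∧ posLE y (0, d)} : ℕ) : ℤ) := by
      exact_mod_cast h1
    rw [e1, e2] at h2
    omega
  · rintro ⟨⟨hm, hw⟩, hr⟩
    refine ⟨⟨hm, hr⟩, ?_⟩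
    rintro ⟨zr, zc⟩ hz
    have hz' : c < zc ∨ (c = zc ∧ zr ≤ r) := hz
    obtain ⟨d, hdc, hd1, hd2⟩ : ∃ d, c ≤ d ∧
        (∀ c', p c' → (c' < d + 1 ↔ (c' < zc ∨ (c' = zc ∧ zr ≤ H c')))) ∧
        (∀ c', m c' → (c' < d + 1 ↔ (c' < zc ∨ (c' = zc ∧ zr ≤ H c' - 1)))) := by
      by_cases hcase : (p zc ∧ zr ≤ H zc) ∨ (m zc ∧ zr ≤ H zc - 1)
      · refine ⟨zc, by omega, ?_, ?_⟩
        · intro c' hc'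
          constructor
          · intro h1
            rcases Nat.eq_or_lt_of_le (Nat.le_of_lt_succ h1) with h3 | h3
            · subst h3
              rcases hcase with h4 | h4
              · exact Or.inr ⟨rfl, h4.2⟩
              · exact absurd h4.1 (dis _ hc')
            · exact Or.inl h3
          · omega
        · intro c' hc'
          constructor
          · intro h1
            rcases Nat.eq_or_lt_of_le (Nat.le_of_lt_succ h1) with h3 | h3
            · subst h3
              rcases hcase with h4 | h4
              · exact absurd hc' (dis _ h4.1)
              · exact Or.inr ⟨rfl, h4.2⟩
            · exact Or.inl h3
          · omega
      · have hcz : c < zc := by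
          rcases hz' with h1 | h1
          · exact h1
          · exfalso; apply hcase; left
            rw [← h1.1]; exact ⟨hm, by omega⟩
        refine ⟨zc - 1, by omega, ?_, ?_⟩
        · intro c' hc'
          constructor
          · omega
          · rintro (h1 | ⟨rfl, h1⟩)
            · omega
            · exact absurd (Or.inl ⟨hc', h1⟩) hcase
        · intro c' hc'
          constructor
          · omega
          · rintro (h1 | ⟨rfl, h1⟩)
            · omega
            · exact absurd (Or.inr ⟨hc', h1⟩) hcase
    have e1 := window hA (W := fun y => posLE (r, c) y ∧ posLE y (zr, zc)) (a := c) (b := d + 1)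
      (by omega) (by
        intro c' hc'
        rw [hd1 c' hc']
        unfold posLE; simp only
        apply and_congr_left
        intro _
        constructor
        · omega
        · intro h2
          rcases Nat.eq_or_lt_of_le h2 with h3 | h3
          · subst h3; omega
          · omega)
    have e2 := window (g := fun c => H c - 1) hB (W := fun y => posLE (r, c) y ∧ posLE y (zr, zc)) (a := c) (b := d + 1)
      (by omega) (by
        intro c' hc'
        have hne : c' ≠ c := by rintro rfl; exact dis _ hm hc'
        rw [hd2 c' hc']
        unfold posLE; simp only
        omega)
    have h2 := hw d hdc
    rw [Sg_Ct, Sg_Ct] at h2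
    have h3 : ((Set.ncard {y | Removable h i lam y ∧ posLE (r, c) y ∧ posLE y (zr, zc)} : ℕ) : ℤ) <
      ((Set.ncard {y | Addable h i lam y ∧ posLE (r, c) y ∧ posLE y (zr, zc)} : ℕ) : ℤ) := by
      rw [e1, e2]; omega
    exact_mod_cast h3

theorem mem_psiSet {h i : ℕ} (hR : RH h (Rr h i)) {lam : BPartition} (V : Vd h (colH lam))
    (x : ℕ × ℕ) :
    x ∈ psiSet h i lam ↔ 1 ≤ x.2 ∧ x.1 < psiC h (Rr h i) (colH lam) x.2 := by
  obtain ⟨r, c⟩ := x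
  have hN : ∀ x, Normal h i lam x ↔ _ := normal_iff hR V
  have hC : ∀ x, Conormal h i lam x ↔ _ := conormal_iff hR V
  have cN : {x | Normal h i lam x}.ncard =
      cntN (Pl h (Rr h i) (colH lam)) (Mi h (Rr h i) (colH lam)) := by
    simp only [hN]
    exact ncard_graph (fun c => Nm (Pl h (Rr h i) (colH lam)) (Mi h (Rr h i) (colH lam)) c)
      (fun c => colH lam c - 1)
  have cC : {x | Conormal h i lam x}.ncard =
      cntC (Pl h (Rr h i) (colH lam)) (Mi h (Rr h i) (colH lam)) := by
    simp only [hC]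
    exact ncard_graph (fun c => Cn (Pl h (Rr h i) (colH lam)) (Mi h (Rr h i) (colH lam)) c)
      (fun c => colH lam c)
  unfold psiSet psiC
  rw [cN, cC]
  split_ifs with hle
  · have e : (r, c) ∈ {x | Conormal h i lam x ∧
        Set.ncard {y | Conormal h i lam y ∧ posLE y x} ≤
        cntC (Pl h (Rr h i) (colH lam)) (Mi h (Rr h i) (colH lam)) -
        cntN (Pl h (Rr h i) (colH lam)) (Mi h (Rr h i) (colH lam))} ↔
        FC (Pl h (Rr h i) (colH lam)) (Mi h (Rr h i) (colH lam)) c ∧ r = colH lam c := by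
      have : r = colH lam c → Set.ncard {y | Conormal h i lam y ∧ posLE y (r, c)} =
          {d | Cn (Pl h (Rr h i) (colH lam)) (Mi h (Rr h i) (colH lam)) d ∧ d ≤ c}.ncard := by
        intro hr
        rw [← ncard_graph _ (colH lam)]
        congr 1
        ext ⟨a, b⟩
        simp only [Set.mem_ofPred_eq, hC]
        unfold posLE
        simp only
        constructor
        · rintro ⟨⟨h1, h2⟩, h3⟩
          exact ⟨⟨h1, by omega⟩, h2⟩
        · rintro ⟨⟨h1, h2⟩, h3⟩
          refine ⟨⟨h1, h3⟩, ?_⟩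
          rcases Nat.eq_or_lt_of_le h2 with h4 | h4
          · subst h4; right; exact ⟨rfl, by omega⟩
          · exact Or.inl h4
      simp only [Set.mem_ofPred_eq, hC (r, c), FC]
      constructor
      · rintro ⟨⟨h1, h2⟩, h3⟩
        rw [this h2] at h3
        exact ⟨⟨h1, h3⟩, h2⟩
      · rintro ⟨⟨h1, h3⟩, h2⟩
        rw [← this h2] at h3
        exact ⟨⟨h1, h2⟩, h3⟩
    rw [Set.mem_union, e, mem_diagram]
    simp only
    by_cases hF : FC (Pl h (Rr h i) (colH lam)) (Mi h (Rr h i) (colH lam)) c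
    · have := hF.1.1.1.1
      rw [ind_pos hF]
      simp only [hF, true_and]
      omega
    · rw [ind_neg hF]
      simp only [hF, false_and, or_false, Nat.add_zero]
  · have e : (r, c) ∈ {x | Normal h i lam x ∧
        Set.ncard {y | Normal h i lam y ∧ posLE x y} ≤
        cntN (Pl h (Rr h i) (colH lam)) (Mi h (Rr h i) (colH lam)) -
        cntC (Pl h (Rr h i) (colH lam)) (Mi h (Rr h i) (colH lam))} ↔
        FN (Pl h (Rr h i) (colH lam)) (Mi h (Rr h i) (colH lam)) c ∧ r = colH lam c - 1 := by
      have : r = colH lam c - 1 → Set.ncard {y | Normal h i lam y ∧ posLE (r, c) y} =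
          {d | Nm (Pl h (Rr h i) (colH lam)) (Mi h (Rr h i) (colH lam)) d ∧ c ≤ d}.ncard := by
        intro hr
        rw [← ncard_graph _ (fun c => colH lam c - 1)]
        congr 1
        ext ⟨a, b⟩
        simp only [Set.mem_ofPred_eq, hN]
        unfold posLE
        simp only
        constructor
        · rintro ⟨⟨h1, h2⟩, h3⟩
          exact ⟨⟨h1, by omega⟩, h2⟩
        · rintro ⟨⟨h1, h2⟩, h3⟩
          refine ⟨⟨h1, h3⟩, ?_⟩
          rcases Nat.eq_or_lt_of_le h2 with h4 | h4
          · subst h4; right; exact ⟨rfl, by omega⟩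
          · exact Or.inl h4
      simp only [Set.mem_ofPred_eq, hN (r, c), FN]
      constructor
      · rintro ⟨⟨h1, h2⟩, h3⟩
        rw [this h2] at h3
        exact ⟨⟨h1, h3⟩, h2⟩
      · rintro ⟨⟨h1, h3⟩, h2⟩
        rw [← this h2] at h3
        exact ⟨⟨h1, h2⟩, h3⟩
    rw [Set.mem_sdiff, e, mem_diagram]
    simp only
    by_cases hF : FN (Pl h (Rr h i) (colH lam)) (Mi h (Rr h i) (colH lam)) c
    · rw [ind_pos hF]
      simp only [hF, true_and]
      omega
    · rw [ind_neg hF]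
      simp only [hF, false_and, not_false_eq_true, and_true, Nat.sub_zero]

theorem psi_main {h i : ℕ} (hR : RH h (Rr h i)) {lam : BPartition} (V : Vd h (colH lam)) :
    colH (psi h i lam) = psiC h (Rr h i) (colH lam) ∧
    Vd h (psiC h (Rr h i) (colH lam)) ∧
    psiC h (Rr h i) (psiC h (Rr h i) (colH lam)) = colH lam ∧
    ((∃ p, Gap h (psiC h (Rr h i) (colH lam)) p) ↔ ∃ p, Gap h (colH lam) p) := by
  obtain ⟨L, hL⟩ := colH_bdd lam
  have hfC : {c | Cn (Pl h (Rr h i) (colH lam)) (Mi h (Rr h i) (colH lam)) c}.Finite :=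
    (Set.finite_le_nat (L + 2)).subset (fun c hc => Pl_bdd hL hc.1)
  have hfN : {c | Nm (Pl h (Rr h i) (colH lam)) (Mi h (Rr h i) (colH lam)) c}.Finite := by
    refine (Set.finite_le_nat L).subset (fun c hc => ?_)
    have h1 := Mi_pos hc.1
    by_contra hcon
    have := hL c (not_le.1 hcon)
    omega
  have main := psiC_main hR V hfC hfN
  refine ⟨?_, main⟩
  have G0 : psiC h (Rr h i) (colH lam) 0 = 0 := by
    unfold psiC
    split_ifs
    · rw [ind_neg, colH_zero]
      intro hx
      have := hx.1.1.1.1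
      omega
    · rw [colH_zero]; omega
  have hfin : ∃ L, ∀ c, L < c → psiC h (Rr h i) (colH lam) c = 0 := by
    refine ⟨L + 2, fun c hc => ?_⟩
    unfold psiC
    split_ifs
    · rw [ind_neg, hL c (by omega)]
      intro hx
      have := Pl_bdd hL hx.1.1
      omega
    · rw [hL c (by omega)]; omega
  obtain ⟨mu, hmu, -⟩ := exists_of_Vd main.1 G0 hfin
  have hex : ∃ mu : BPartition, diagram mu = psiSet h i lam := by
    refine ⟨mu, ?_⟩
    ext x
    rw [mem_psiSet hR V, mem_diagram, hmu]
  apply colH_eq_of G0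
  intro x
  unfold psi
  rw [dif_pos hex, hex.choose_spec, mem_psiSet hR V]

end SigP

open BPartition in
/-- ψ_i is an involution on h-strict partitions, preserving restrictedness. -/
theorem stmt2 (n h : ℕ) (hn : 1 ≤ n) (hh : h = 2 * n + 1) (i : ℕ) (hi : i ≤ n)
    (lam : BPartition) (hlam : IsHStrict h lam) :
    psi h i (psi h i lam) = lam ∧
    (IsRestricted h (psi h i lam) ↔ IsRestricted h lam) := by
  have hR : SigP.RH h (SigP.Rr h i) := SigP.Rr_RH hn hh
  have V := (SigP.hstrict_iff h lam).1 hlam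
  obtain ⟨e1, V1, e2, hg⟩ := SigP.psi_main hR V
  have V' : SigP.Vd h (SigP.colH (psi h i lam)) := by rw [e1]; exact V1
  refine ⟨?_, ?_⟩
  · apply SigP.ext_colH
    rw [(SigP.psi_main hR V').1, e1, e2]
  · rw [SigP.restricted_iff h hR.h3, SigP.restricted_iff h hR.h3, e1, hg]
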